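/- Small-sized key achievability: if 0 < p < q < 1/2, ε_d ∈ (0,1), and I_B(p,q) > I_J(q), then for every δ > 0 the relative throughput t(q,ε_d)·I_B(p,q) − δ is achievable with key sizes Δ(n) = ⌈6 log₂ n⌉: there exists a (1 − ε_d)-covert sequence of codes with ⌈6 log₂ n⌉ key bits, (log₂ N_n)/√n ≥ t(q,ε_d)·I_B(p,q) − δ for all sufficiently large n, and P_err → 0. Combined with the converse, the covert capacity in this regime equals t(q,ε_d)·I_B(p,q). -/

import Mathlib

/-!
Covert communication over an adversarially jammed binary channel.

A code with blocklength `n`, `N` messages and `Δ` key bits consists of an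
encoder `Fin N → key → {0,1}^n` and a decoder `{0,1}^n → key → {0,…,N}`
(we model the output `0` ("declare silence") as `Option.none`).
When Alice is silent she transmits the all-zeros vector.
James observes `Z = X ⊕ S̄` with `S̄` i.i.d. Bernoulli(q); a jamming strategy is a
stochastic kernel from observations `z` to jamming vectors `s` of Hamming
weight at most `p·n`.  Bob receives `Y = X ⊕ S`.
-/

namespace CovertComm

open Finset Filter

/-- Binary vectors of length `n`. -/
abbrev BV (n : ℕ) := Fin n → Bool

/-- Coordinatewise XOR of binary vectors. -/
def vxor {n : ℕ} (x y : BV n) : BV n := fun i => Bool.xor (x i) (y i)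

/-- Hamming weight. -/
def wt {n : ℕ} (x : BV n) : ℕ := (Finset.univ.filter fun i => x i = true).card

/-- Probability that an i.i.d. Bernoulli(q) noise vector equals `z`. -/
noncomputable def noiseP {n : ℕ} (q : ℝ) (z : BV n) : ℝ :=
  ∏ i, if z i then q else 1 - q

/-- A code: encoder and decoder.  Decoder output `none` means "declare 0 (silence)". -/
structure Code (n N Δ : ℕ) where
  enc : Fin N → BV Δ → BV n
  dec : BV n → BV Δ → Option (Fin N)

/-- A jamming strategy: a stochastic kernel `W z s`, supported on jamming
vectors of Hamming weight at most `p·n`. -/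
structure Jammer (n : ℕ) (p : ℝ) where
  W : BV n → BV n → ℝ
  nonneg : ∀ z s, 0 ≤ W z s
  sum_one : ∀ z, ∑ s : BV n, W z s = 1
  wt_le : ∀ z s, W z s ≠ 0 → (wt s : ℝ) ≤ p * n

/-- False-alarm probability of detector `Φ`: when `T = 0`, `Z` is pure
Bernoulli(q) noise. -/
noncomputable def PFA {n : ℕ} (q : ℝ) (Φ : BV n → Bool) : ℝ :=
  ∑ z : BV n, noiseP q z * (if Φ z then (1 : ℝ) else 0)

/-- Missed-detection probability of detector `Φ`: when `T = 1`, the message and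
key are uniform and `Z = Enc(M,K) ⊕ S̄`. -/
noncomputable def PMD {n N Δ : ℕ} (q : ℝ) (C : Code n N Δ) (Φ : BV n → Bool) : ℝ :=
  (1 / ((N : ℝ) * 2 ^ Δ)) * ∑ m : Fin N, ∑ k : BV Δ, ∑ z : BV n,
    noiseP q (vxor z (C.enc m k)) * (if Φ z then (0 : ℝ) else 1)

/-- Probability of decoding error when Alice is active:
`P(Dec(Enc(M,K) ⊕ S, K) ≠ M | T = 1)` with uniform `M, K`, where
`S` is drawn from `J.W` applied to James' observation `Enc(M,K) ⊕ S̄`. -/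
noncomputable def errActive {n N Δ : ℕ} {p : ℝ} (q : ℝ) (C : Code n N Δ)
    (J : Jammer n p) : ℝ :=
  (1 / ((N : ℝ) * 2 ^ Δ)) * ∑ m : Fin N, ∑ k : BV Δ, ∑ zb : BV n,
    noiseP q zb * ∑ s : BV n, J.W (vxor (C.enc m k) zb) s *
      (if C.dec (vxor (C.enc m k) s) k = some m then (0 : ℝ) else 1)

/-- Probability of decoding error when Alice is silent:
`P(Dec(S, K) ≠ 0 | T = 0)`, where `S` is drawn from `J.W` applied to the pure
noise observation. -/
noncomputable def errSilent {n N Δ : ℕ} {p : ℝ} (q : ℝ) (C : Code n N Δ)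
    (J : Jammer n p) : ℝ :=
  (1 / (2 ^ Δ : ℝ)) * ∑ k : BV Δ, ∑ zb : BV n,
    noiseP q zb * ∑ s : BV n, J.W zb s *
      (if C.dec s k = Option.none then (0 : ℝ) else 1)

/-- `P_err`: worst case over jamming strategies of the sum of the two error
probabilities. -/
noncomputable def Perr {n N Δ : ℕ} (p q : ℝ) (C : Code n N Δ) : ℝ :=
  ⨆ J : Jammer n p, (errSilent q C J + errActive q C J)

/-- `min_Φ (P_FA(Φ) + P_MD(Φ))` for a given code. -/
noncomputable def covertGap {n N Δ : ℕ} (q : ℝ) (C : Code n N Δ) : ℝ :=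
  ⨅ Φ : BV n → Bool, (PFA q Φ + PMD q C Φ)

/-- A sequence of codes is `(1 − εd)`-covert if
`liminf_n min_Φ (P_FA + P_MD) ≥ 1 − εd`. -/
def IsCovertSeq (q εd : ℝ) (N Δ : ℕ → ℕ) (C : ∀ n, Code n (N n) (Δ n)) : Prop :=
  1 - εd ≤ Filter.liminf (fun n => covertGap q (C n)) Filter.atTop

/-- Relative throughput `r` is achievable with key sizes `Δ(n)`: there is a
`(1 − εd)`-covert sequence of codes with `Δ(n)` key bits, relative throughput
at least `r` at every (positive) blocklength, and `P_err → 0`. -/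
def Achievable (p q εd : ℝ) (Δ : ℕ → ℕ) (r : ℝ) : Prop :=
  ∃ (N : ℕ → ℕ) (C : ∀ n, Code n (N n) (Δ n)),
    IsCovertSeq q εd N Δ C ∧
    (∀ n : ℕ, 1 ≤ n → r ≤ Real.logb 2 (N n) / Real.sqrt n) ∧
    Filter.Tendsto (fun n => Perr p q (C n)) Filter.atTop (nhds 0)

/-- The Gaussian `Q`-function. -/
noncomputable def Qfun (x : ℝ) : ℝ :=
  ∫ u in Set.Ioi x, Real.exp (-u ^ 2 / 2) / Real.sqrt (2 * Real.pi)

/-- Inverse of the `Q`-function. -/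
noncomputable def Qinv : ℝ → ℝ := Function.invFun Qfun

/-- The code-weight parameter `t(q, εd)`. -/
noncomputable def tpar (q εd : ℝ) : ℝ :=
  2 * Real.sqrt (q * (1 - q)) / (1 - 2 * q) * Qinv ((1 - εd) / 2)

/-- Weight-normalized mutual information for Bob, `I_B(p,q)`. -/
noncomputable def IB (p q : ℝ) : ℝ :=
  p * (q - 1) / q *
      Real.logb 2 ((q - p + p * q) * (1 - p) / (p ^ 2 * (1 - q)))
    + Real.logb 2 ((q - p + p * q) / (p * q))

/-- Weight-normalized mutual information for James, `I_J(q)`. -/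
noncomputable def IJ (q : ℝ) : ℝ := (1 - 2 * q) * Real.logb 2 ((1 - q) / q)

end CovertComm

namespace CovertComm

open Finset

section FiniteProbability

variable {α ι : Type*} [Fintype α] [Fintype ι]

open scoped Classical in
/-- Mass that the weights `P` give to the event `E`. -/
noncomputable def prob (P : α → ℝ) (E : α → Prop) : ℝ := ∑ a, if E a then P a else 0

/-- `P` is a probability distribution on a finite type. -/
structure IsDist (P : α → ℝ) : Prop where
  nonneg : ∀ a, 0 ≤ P a
  sum_one : ∑ a, P a = 1

/-- Product weights on functions. -/
noncomputable def prodDist (P : α → ℝ) (c : ι → α) : ℝ := ∏ i, P (c i)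

theorem prob_nonneg {P : α → ℝ} (hP : ∀ a, 0 ≤ P a) (E : α → Prop) : 0 ≤ prob P E := by
  classical
  exact Finset.sum_nonneg fun a _ => by split_ifs <;> simp [hP a]

theorem prob_le_sum_mul {P f : α → ℝ} {E : α → Prop} (hP : ∀ a, 0 ≤ P a)
    (hf : ∀ a, 0 ≤ f a) (hE : ∀ a, E a → 1 ≤ f a) : prob P E ≤ ∑ a, P a * f a := by
  classical
  refine Finset.sum_le_sum fun a _ => ?_
  split_ifs with h
  · exact le_mul_of_one_le_right (hP a) (hE a h)
  · exact mul_nonneg (hP a) (hf a)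

theorem prob_mono {P : α → ℝ} {E F : α → Prop} (hP : ∀ a, 0 ≤ P a)
    (h : ∀ a, E a → F a) : prob P E ≤ prob P F := by
  classical
  refine Finset.sum_le_sum fun a _ => ?_
  by_cases hE : E a
  · simp [hE, h a hE]
  · simp only [hE, if_false]; split_ifs <;> simp [hP a]

theorem prob_le_one {P : α → ℝ} (hP : IsDist P) (E : α → Prop) : prob P E ≤ 1 := by
  classical
  rw [← hP.sum_one]
  exact Finset.sum_le_sum fun a _ => by split_ifs <;> simp [hP.nonneg a]

theorem prob_add_prob_not (P : α → ℝ) (E : α → Prop) :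
    prob P E + prob P (fun a => ¬ E a) = ∑ a, P a := by
  classical
  unfold prob
  rw [← Finset.sum_add_distrib]
  exact Finset.sum_congr rfl fun a _ => by by_cases h : E a <;> simp [h]

theorem prob_or_le {P : α → ℝ} (hP : ∀ a, 0 ≤ P a) (E F : α → Prop) :
    prob P (fun a => E a ∨ F a) ≤ prob P E + prob P F := by
  classical
  unfold prob
  rw [← Finset.sum_add_distrib]
  refine Finset.sum_le_sum fun a _ => ?_
  have := hP a
  by_cases h : E a <;> by_cases h' : F a <;> simp [h, h', this]

theorem prob_exists_le {P : α → ℝ} (hP : ∀ a, 0 ≤ P a) (E : ι → α → Prop) :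
    prob P (fun a => ∃ j, E j a) ≤ ∑ j, prob P (E j) := by
  classical
  unfold prob
  rw [Finset.sum_comm]
  refine Finset.sum_le_sum fun a _ => ?_
  have h0 : ∀ j ∈ (Finset.univ : Finset ι), 0 ≤ if E j a then P a else 0 := fun j _ => by
    split_ifs <;> simp [hP a]
  split_ifs with h
  · obtain ⟨j, hj⟩ := h
    calc P a = if E j a then P a else 0 := by simp [hj]
      _ ≤ _ := Finset.single_le_sum h0 (Finset.mem_univ j)
  · exact Finset.sum_nonneg h0

theorem prob_exists_le_card_mul {P : α → ℝ} (hP : ∀ a, 0 ≤ P a) (E : ι → α → Prop) {B : ℝ}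
    (hB : ∀ j, prob P (E j) ≤ B) :
    prob P (fun a => ∃ j, E j a) ≤ Fintype.card ι * B := by
  refine (prob_exists_le hP E).trans ((Finset.sum_le_sum fun j _ => hB j).trans ?_)
  simp

theorem exists_not_of_prob_lt_one {P : α → ℝ} (hP : IsDist P) {E : α → Prop}
    (h : prob P E < 1) : ∃ a, 0 < P a ∧ ¬ E a := by
  classical
  by_contra! hcon
  have : prob P E = 1 := by
    rw [← hP.sum_one]
    refine Finset.sum_congr rfl fun a _ => ?_
    rcases (hP.nonneg a).lt_or_eq with h0 | h0
    · simp [hcon a h0]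
    · simp [← h0]
  linarith

variable [DecidableEq ι]

theorem sum_prodDist_mul (P : α → ℝ) (g : ι → α → ℝ) :
    ∑ c : ι → α, prodDist P c * ∏ i, g i (c i) = ∏ i, ∑ a, P a * g i a := by
  classical
  simp only [prodDist, ← Finset.prod_mul_distrib]
  exact (Fintype.prod_sum fun i a => P a * g i a).symm

theorem isDist_prodDist {P : α → ℝ} (hP : IsDist P) :
    IsDist (prodDist P : (ι → α) → ℝ) where
  nonneg c := Finset.prod_nonneg fun i _ => hP.nonneg _
  sum_one := by
    have := sum_prodDist_mul P (fun (_ : ι) (_ : α) => (1 : ℝ))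
    simpa [hP.sum_one] using this

theorem prob_prodDist_coord {P : α → ℝ} (hP : IsDist P) (i : ι) (E : α → Prop) :
    prob (prodDist P) (fun c : ι → α => E (c i)) = prob P E := by
  classical
  have h := sum_prodDist_mul P
    (fun (j : ι) (a : α) => if j = i then (if E a then (1 : ℝ) else 0) else 1)
  simp only [Finset.prod_ite_eq', Finset.mem_univ, if_true] at h
  have hR : ∏ j : ι, ∑ a, P a * (if j = i then (if E a then (1 : ℝ) else 0) else 1)
      = prob P E := by
    rw [Finset.prod_eq_single i]
    · simp [prob]
    · intro j _ hj
      simp [hj, hP.sum_one]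
    · simp
  rw [hR] at h
  rw [← h]
  simp [prob]

theorem prob_prodDist_pair_le {P : α → ℝ} (hP : IsDist P) {i j : ι} (hij : i ≠ j)
    (E : α → α → Prop) {B : ℝ} (hE : ∀ a, 0 < P a → prob P (E a) ≤ B) :
    prob (prodDist P) (fun c : ι → α => E (c i) (c j)) ≤ B := by
  classical
  have h1 : prob (prodDist P) (fun c : ι → α => E (c i) (c j))
      = ∑ a, P a * prob P (E a) := by
    have key : ∀ a, ∑ c : ι → α, prodDist P c *
        (if c i = a then (if E a (c j) then (1 : ℝ) else 0) else 0) = P a * prob P (E a) := by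
      intro a
      have h := sum_prodDist_mul P (fun (k : ι) (b : α) =>
        (if k = i then (if b = a then (1 : ℝ) else 0) else 1) *
        (if k = j then (if E a b then (1 : ℝ) else 0) else 1))
      simp only [Finset.prod_mul_distrib, Finset.prod_ite_eq', Finset.mem_univ, if_true] at h
      have hR : ∏ k : ι, ∑ b, P b * ((if k = i then (if b = a then (1 : ℝ) else 0) else 1) *
          (if k = j then (if E a b then (1 : ℝ) else 0) else 1)) = P a * prob P (E a) := by
        rw [← Finset.prod_subset (Finset.subset_univ {i, j}), Finset.prod_pair hij]
        · congr 1
          · simp [hij]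
          · simp [hij.symm, prob]
        · intro k _ hk
          simp only [Finset.mem_insert, Finset.mem_singleton, not_or] at hk
          simp [hk.1, hk.2, hP.sum_one]
      rw [hR] at h
      rw [← h]
      refine Finset.sum_congr rfl fun c _ => ?_
      split_ifs <;> simp
    rw [← Finset.sum_congr rfl fun a _ => key a, Finset.sum_comm]
    refine Finset.sum_congr rfl fun c _ => ?_
    rw [← Finset.mul_sum]
    simp
  rw [h1]
  calc ∑ a, P a * prob P (E a) ≤ ∑ a, P a * B := by
        refine Finset.sum_le_sum fun a _ => ?_
        rcases (hP.nonneg a).lt_or_eq with h0 | h0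
        · exact mul_le_mul_of_nonneg_left (hE a h0) h0.le
        · simp [← h0]
    _ = B := by rw [← Finset.sum_mul, hP.sum_one, one_mul]

/-- Chernoff bound for sums of independent copies of a `[0, B]`-valued function. -/
theorem prob_prodDist_sum_ge_le {P : α → ℝ} (hP : IsDist P) {f : α → ℝ} {B μ lam T : ℝ}
    (hB : 0 < B) (hf0 : ∀ a, 0 ≤ f a) (hfB : ∀ a, f a ≤ B) (hμ : ∑ a, P a * f a ≤ μ)
    (hlam : 0 ≤ lam) :
    prob (prodDist P) (fun c : ι → α => T ≤ ∑ i, f (c i)) ≤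
      Real.exp (Fintype.card ι * ((Real.exp lam - 1) * μ / B) - lam * T / B) := by
  have hprod := isDist_prodDist (ι := ι) hP
  have hconv : ∀ x, 0 ≤ x → x ≤ 1 → Real.exp (lam * x) ≤ 1 + (Real.exp lam - 1) * x := by
    intro x hx0 hx1
    have := convexOn_exp.2 (Set.mem_univ (0 : ℝ)) (Set.mem_univ lam)
      (sub_nonneg.2 hx1) hx0 (by ring)
    simp only [smul_eq_mul, mul_zero, zero_add, Real.exp_zero, mul_one] at this
    rw [mul_comm x lam] at this
    linarith
  calc prob (prodDist P) (fun c : ι → α => T ≤ ∑ i, f (c i))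
      ≤ ∑ c : ι → α, prodDist P c *
          (Real.exp (-(lam * T / B)) * ∏ i, Real.exp (lam * (f (c i) / B))) := by
        refine prob_le_sum_mul hprod.nonneg (fun c => by positivity) fun c hc => ?_
        rw [← Real.exp_sum, ← Real.exp_add]
        refine Real.one_le_exp ?_
        rw [← Finset.mul_sum, ← Finset.sum_div, mul_div_assoc]
        have : T / B ≤ (∑ i, f (c i)) / B := by gcongr
        nlinarith
    _ = Real.exp (-(lam * T / B)) * ∏ _i : ι, ∑ a, P a * Real.exp (lam * (f a / B)) := by
        rw [← sum_prodDist_mul, Finset.mul_sum]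
        exact Finset.sum_congr rfl fun c _ => by ring
    _ ≤ Real.exp (-(lam * T / B)) * ∏ _i : ι, Real.exp ((Real.exp lam - 1) * μ / B) := by
        refine mul_le_mul_of_nonneg_left ?_ (Real.exp_nonneg _)
        refine Finset.prod_le_prod (fun i _ => Finset.sum_nonneg fun a _ =>
          mul_nonneg (hP.nonneg a) (Real.exp_nonneg _)) fun i _ => ?_
        calc ∑ a, P a * Real.exp (lam * (f a / B))
            ≤ ∑ a, (P a + (Real.exp lam - 1) / B * (P a * f a)) := by
              refine Finset.sum_le_sum fun a _ => ?_
              have := mul_le_mul_of_nonneg_left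
                (hconv (f a / B) (div_nonneg (hf0 a) hB.le) ((div_le_one hB).2 (hfB a)))
                (hP.nonneg a)
              refine this.trans (le_of_eq ?_)
              ring
          _ = 1 + (Real.exp lam - 1) / B * ∑ a, P a * f a := by
              rw [Finset.sum_add_distrib, hP.sum_one, Finset.mul_sum]
          _ ≤ 1 + (Real.exp lam - 1) * μ / B := by
              have h0 : 0 ≤ (Real.exp lam - 1) / B :=
                div_nonneg (sub_nonneg.2 (Real.one_le_exp hlam)) hB.le
              have := mul_le_mul_of_nonneg_left hμ h0
              have e : (Real.exp lam - 1) * μ / B = (Real.exp lam - 1) / B * μ := by ring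
              linarith
          _ ≤ _ := by rw [add_comm]; exact Real.add_one_le_exp _
    _ = _ := by
        rw [Finset.prod_const, ← Real.exp_nat_mul, ← Real.exp_add, Finset.card_univ]
        congr 1
        ring

/-- Relative upper deviation of the empirical mean of a `[0, B]`-valued function. -/
theorem prob_prodDist_mean_gt_le {P : α → ℝ} (hP : IsDist P) {f : α → ℝ} {B μ η : ℝ}
    (hB : 0 < B) (hf0 : ∀ a, 0 ≤ f a) (hfB : ∀ a, f a ≤ B) (hμ : ∑ a, P a * f a ≤ μ)
    (hη0 : 0 ≤ η) (hη1 : η ≤ 1) :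
    prob (prodDist P)
      (fun c : ι → α => Fintype.card ι * ((1 + η) * μ + η) < ∑ i, f (c i)) ≤
      Real.exp (-(η ^ 2 * Fintype.card ι / B)) := by
  have hμ0 : 0 ≤ μ := le_trans (Finset.sum_nonneg fun a _ => mul_nonneg (hP.nonneg a) (hf0 a)) hμ
  refine (prob_mono (isDist_prodDist hP).nonneg fun c hc => hc.le).trans
    ((prob_prodDist_sum_ge_le hP hB hf0 hfB hμ hη0).trans (Real.exp_le_exp.2 ?_))
  have he : Real.exp η - 1 ≤ η * (1 + η) := by
    have := (abs_le.1 (Real.abs_exp_sub_one_sub_id_le (by rwa [abs_of_nonneg hη0]))).2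
    nlinarith
  have hc : (0 : ℝ) ≤ Fintype.card ι / B := by positivity
  have : (Fintype.card ι : ℝ) / B * ((Real.exp η - 1) * μ) ≤
      Fintype.card ι / B * (η * (1 + η) * μ) :=
    mul_le_mul_of_nonneg_left (mul_le_mul_of_nonneg_right he hμ0) hc
  have e1 : (Fintype.card ι : ℝ) * ((Real.exp η - 1) * μ / B) =
    Fintype.card ι / B * ((Real.exp η - 1) * μ) := by ring
  rw [e1]
  refine (sub_le_sub_right this _).trans (le_of_eq ?_)
  ring

end FiniteProbability

section BernoulliVectors

variable {n : ℕ}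

/-- Sum of the weights `a i` over the support of `x`. -/
noncomputable def lin (a : Fin n → ℝ) (x : BV n) : ℝ := ∑ i, if x i then a i else 0

/-- Real-valued indicator of the support of `s`. -/
noncomputable def ind (s : BV n) (i : Fin n) : ℝ := if s i then 1 else 0

/-- Number of common ones of `s` and `x`. -/
noncomputable def ov (s x : BV n) : ℝ := lin (ind s) x

/-- Signs of the coordinates of `z`: `1` at ones and `-1` at zeros. -/
noncomputable def sgn (z : BV n) (i : Fin n) : ℝ := if z i then 1 else -1

/-- Log-likelihood ratio of a single use of James' channel with crossover probability `q`. -/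
noncomputable def llr (q : ℝ) : ℝ := Real.log ((1 - q) / q)

theorem lin_add (a b : Fin n → ℝ) (x : BV n) : lin (fun i => a i + b i) x = lin a x + lin b x := by
  unfold lin
  rw [← Finset.sum_add_distrib]
  exact Finset.sum_congr rfl fun i _ => by split_ifs <;> simp

theorem lin_mul (c : ℝ) (a : Fin n → ℝ) (x : BV n) : lin (fun i => c * a i) x = c * lin a x := by
  unfold lin
  rw [Finset.mul_sum]
  exact Finset.sum_congr rfl fun i _ => by split_ifs <;> simp

theorem sum_ind (s : BV n) : ∑ i, ind s i = wt s := by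
  simp [ind, wt]

theorem lin_one (x : BV n) : lin (fun _ => 1) x = wt x := by
  simp [lin, wt]

theorem sum_if_eq (s : BV n) (u v : ℝ) :
    ∑ i, (if s i then u else v) = wt s * u + (n - wt s) * v := by
  have : ∀ i, (if s i then u else v) = v + ind s i * (u - v) := fun i => by
    unfold ind; split_ifs <;> ring
  simp only [this]
  rw [Finset.sum_add_distrib, ← Finset.sum_mul, sum_ind]
  simp
  ring

theorem ov_comm (s x : BV n) : ov s x = ov x s := by
  unfold ov lin ind
  exact Finset.sum_congr rfl fun i _ => by split_ifs <;> rfl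

theorem ov_vxor_self (x s : BV n) : ov (vxor x s) x = wt x - ov s x := by
  rw [← lin_one]
  unfold ov lin
  rw [← Finset.sum_sub_distrib]
  refine Finset.sum_congr rfl fun i _ => ?_
  unfold ind vxor
  cases x i <;> cases s i <;> simp

theorem ov_vxor_le (x s y : BV n) : ov (vxor x s) y ≤ ov x y + ov s y := by
  unfold ov lin
  rw [← Finset.sum_add_distrib]
  refine Finset.sum_le_sum fun i _ => ?_
  unfold ind vxor
  cases x i <;> cases s i <;> cases y i <;> simp

theorem lin_sgn_vxor (x z : BV n) : lin (sgn (vxor x z)) x = wt x - 2 * ov x z := by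
  rw [← lin_one, ov_comm]
  unfold ov lin
  rw [Finset.mul_sum, ← Finset.sum_sub_distrib]
  refine Finset.sum_congr rfl fun i _ => ?_
  rcases hx : x i <;> rcases hz : z i <;> norm_num [ind, vxor, sgn, hx, hz]

theorem vxor_comm (x y : BV n) : vxor x y = vxor y x := by
  funext i; simp [vxor, Bool.xor_comm]

theorem vxor_vxor_cancel (x y : BV n) : vxor x (vxor x y) = y := by
  funext i; simp [vxor]

/-- Translation by `x` as a permutation of the binary vectors. -/
def vxorEquiv (x : BV n) : BV n ≃ BV n where
  toFun := vxor x
  invFun := vxor x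
  left_inv := vxor_vxor_cancel x
  right_inv := vxor_vxor_cancel x

theorem sum_vxor (x : BV n) (f : BV n → ℝ) : ∑ z, f (vxor x z) = ∑ z, f z :=
  (vxorEquiv x).sum_comp f

theorem sum_noiseP_mul_prod (ρ : ℝ) (g : Fin n → Bool → ℝ) :
    ∑ x, noiseP ρ x * ∏ i, g i (x i) = ∏ i, (ρ * g i true + (1 - ρ) * g i false) := by
  unfold noiseP
  simp only [← Finset.prod_mul_distrib]
  rw [← Fintype.prod_sum fun i (b : Bool) => (if b then ρ else 1 - ρ) * g i b]
  simp

theorem noiseP_nonneg {ρ : ℝ} (h0 : 0 ≤ ρ) (h1 : ρ ≤ 1) (x : BV n) : 0 ≤ noiseP ρ x :=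
  Finset.prod_nonneg fun i _ => by split_ifs <;> linarith

theorem isDist_noiseP {ρ : ℝ} (h0 : 0 ≤ ρ) (h1 : ρ ≤ 1) : IsDist (noiseP ρ : BV n → ℝ) where
  nonneg := noiseP_nonneg h0 h1
  sum_one := by
    have := sum_noiseP_mul_prod (n := n) ρ (fun _ _ => 1)
    simpa using this

theorem sum_noiseP_mul_exp_lin (ρ : ℝ) (a : Fin n → ℝ) :
    ∑ x, noiseP ρ x * Real.exp (lin a x) = ∏ i, (1 + ρ * (Real.exp (a i) - 1)) := by
  have h := sum_noiseP_mul_prod ρ (fun i b => Real.exp (if b then a i else 0))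
  simp only [← Real.exp_sum] at h
  rw [show (∑ x, noiseP ρ x * Real.exp (lin a x)) = _ from h]
  refine Finset.prod_congr rfl fun i _ => ?_
  simp
  ring

theorem prob_noiseP_lin_ge_le {ρ : ℝ} (h0 : 0 ≤ ρ) (h1 : ρ ≤ 1) (a : Fin n → ℝ) (T : ℝ) :
    prob (noiseP ρ) (fun x => T ≤ lin a x) ≤
      Real.exp (ρ * ∑ i, (Real.exp (a i) - 1) - T) := by
  calc prob (noiseP ρ) (fun x => T ≤ lin a x)
      ≤ ∑ x, noiseP ρ x * (Real.exp (-T) * Real.exp (lin a x)) := by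
        refine prob_le_sum_mul (noiseP_nonneg h0 h1) (fun x => by positivity) fun x hx => ?_
        rw [← Real.exp_add]
        exact Real.one_le_exp (by linarith)
    _ = Real.exp (-T) * ∏ i, (1 + ρ * (Real.exp (a i) - 1)) := by
        rw [← sum_noiseP_mul_exp_lin, Finset.mul_sum]
        exact Finset.sum_congr rfl fun c _ => by ring
    _ ≤ Real.exp (-T) * ∏ i, Real.exp (ρ * (Real.exp (a i) - 1)) := by
        refine mul_le_mul_of_nonneg_left ?_ (Real.exp_nonneg _)
        refine Finset.prod_le_prod (fun i _ => ?_) fun i _ => ?_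
        · nlinarith [mul_nonneg h0 (Real.exp_nonneg (a i))]
        · rw [add_comm]; exact Real.add_one_le_exp _
    _ = _ := by
        rw [← Real.exp_sum, ← Real.exp_add, ← Finset.mul_sum]
        congr 1
        ring

theorem exp_sub_one_le {x : ℝ} (hx : |x| ≤ 1) : Real.exp x - 1 ≤ x + x ^ 2 := by
  linarith [(abs_le.1 (Real.abs_exp_sub_one_sub_id_le hx)).2]

theorem prob_noiseP_ov_ge_le {ρ : ℝ} (h0 : 0 ≤ ρ) (h1 : ρ ≤ 1) (s : BV n) {lam : ℝ}
    (hlam : 0 ≤ lam) (T : ℝ) :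
    prob (noiseP ρ) (fun x => T ≤ ov s x) ≤
      Real.exp (ρ * (wt s * (Real.exp lam - 1)) - lam * T) := by
  refine (prob_mono (noiseP_nonneg h0 h1) (F := fun x => lam * T ≤ lin (fun i => lam * ind s i) x)
    fun x hx => ?_).trans ((prob_noiseP_lin_ge_le h0 h1 _ _).trans (le_of_eq ?_))
  · rw [lin_mul]
    exact mul_le_mul_of_nonneg_left hx hlam
  · have : ∀ i, Real.exp (lam * ind s i) - 1 = ind s i * (Real.exp lam - 1) := fun i => by
      unfold ind; split_ifs <;> simp
    simp only [this]
    rw [← Finset.sum_mul, sum_ind]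

/-- The weight of an i.i.d. Bernoulli vector concentrates around its mean. -/
theorem prob_noiseP_not_typical_le {ρ η : ℝ} (h0 : 0 ≤ ρ) (h1 : ρ ≤ 1) (hη0 : 0 ≤ η)
    (hη1 : η ≤ 1) :
    prob (noiseP ρ : BV n → ℝ) (fun x => ¬ |(wt x : ℝ) - n * ρ| ≤ η * (n * ρ)) ≤
      2 * Real.exp (-(η ^ 2 * (n * ρ) / 4)) := by
  have hn : (0 : ℝ) ≤ n * ρ := by positivity
  have tail : ∀ lam : ℝ, |lam| ≤ 1 → ∀ T : ℝ,
      prob (noiseP ρ : BV n → ℝ) (fun x => T ≤ lam * wt x) ≤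
        Real.exp (n * ρ * (lam + lam ^ 2) - T) := by
    intro lam hlam T
    refine (prob_mono (noiseP_nonneg h0 h1) (F := fun x : BV n => T ≤ lin (fun _ => lam * 1) x)
      fun x hx => ?_).trans ((prob_noiseP_lin_ge_le h0 h1 _ _).trans (Real.exp_le_exp.2 ?_))
    · rwa [lin_mul, lin_one]
    · simp only [mul_one, Finset.sum_const, Finset.card_univ, Fintype.card_fin, nsmul_eq_mul]
      have := mul_le_mul_of_nonneg_left (exp_sub_one_le hlam) hn
      linarith
  have hle : |η / 2| ≤ 1 := by rw [abs_of_nonneg (by linarith)]; linarith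
  refine (prob_mono (noiseP_nonneg h0 h1) (F := fun x : BV n =>
    (η / 2 * ((1 + η) * (n * ρ)) ≤ η / 2 * wt x) ∨
    (-(η / 2) * ((1 - η) * (n * ρ)) ≤ -(η / 2) * wt x)) fun x hx => ?_).trans
    ((prob_or_le (noiseP_nonneg h0 h1) _ _).trans ?_)
  · rw [abs_le, not_and_or, not_le, not_le] at hx
    rcases hx with h | h
    · right; nlinarith
    · left; nlinarith
  · refine (add_le_add (tail _ hle _) (tail _ (by rwa [abs_neg]) _)).trans (le_of_eq ?_)
    rw [two_mul]
    congr 2 <;> ring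

/-- The channel noise flips about a fraction `q` of the ones of `x`. -/
theorem prob_noiseP_sgn_gt_le {q η w : ℝ} (hq0 : 0 ≤ q) (hq2 : q ≤ 1 / 2) (hη0 : 0 ≤ η)
    (hη1 : η ≤ 1) (hw : 0 ≤ w) (x : BV n) (hx : (wt x : ℝ) ≤ (1 + η) * w) :
    prob (noiseP q) (fun z => (1 - 2 * q + 2 * η) * w < lin (sgn (vxor x z)) x) ≤
      Real.exp (-(η ^ 2 * w / 16)) := by
  have hq1 : q ≤ 1 := by linarith
  set lam := η / 8 with hlam
  refine (prob_mono (noiseP_nonneg hq0 hq1) (F := fun z =>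
    lam * ((1 - 2 * q + 2 * η) * w) - lam * wt x ≤ lin (fun i => (-2 * lam) * ind x i) z)
    fun z hz => ?_).trans ((prob_noiseP_lin_ge_le hq0 hq1 _ _).trans (Real.exp_le_exp.2 ?_))
  · rw [lin_mul, show lin (ind x) z = ov x z from rfl]
    rw [lin_sgn_vxor] at hz
    have : 0 ≤ lam := by positivity
    nlinarith
  · have : ∀ i, Real.exp ((-2 * lam) * ind x i) - 1 = ind x i * (Real.exp (-2 * lam) - 1) :=
      fun i => by unfold ind; split_ifs <;> simp
    simp only [this]
    rw [← Finset.sum_mul, sum_ind]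
    have he : Real.exp (-2 * lam) - 1 ≤ -2 * lam + (-2 * lam) ^ 2 := by
      refine exp_sub_one_le ?_
      rw [abs_le, hlam]; constructor <;> linarith
    have hwt : (0 : ℝ) ≤ wt x := by positivity
    have hl0 : 0 ≤ lam := by positivity
    have h1 : q * (wt x * (Real.exp (-2 * lam) - 1)) ≤
        wt x * (q * (-2 * lam + (-2 * lam) ^ 2)) := by
      have := mul_le_mul_of_nonneg_left he (mul_nonneg hq0 hwt)
      linarith
    have h2 : q * (4 * lam ^ 2) ≤ 2 * lam ^ 2 := by nlinarith [sq_nonneg lam]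
    have h3 : (wt x : ℝ) * (lam * (1 - 2 * q) + 2 * lam ^ 2) ≤
        (1 + η) * w * (lam * (1 - 2 * q) + 2 * lam ^ 2) := by
      refine mul_le_mul_of_nonneg_right hx ?_
      have : 0 ≤ lam * (1 - 2 * q) := mul_nonneg hl0 (by linarith)
      positivity
    have h4 : (wt x : ℝ) * (q * (4 * lam ^ 2)) ≤ wt x * (2 * lam ^ 2) :=
      mul_le_mul_of_nonneg_left h2 hwt
    have h5 : (1 + η) * w * (lam * (1 - 2 * q) + 2 * lam ^ 2) -
        lam * ((1 - 2 * q + 2 * η) * w) ≤ -(η ^ 2 * w / 16) := by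
      have e : (1 + η) * (lam * (1 - 2 * q) + 2 * lam ^ 2) - lam * (1 - 2 * q + 2 * η) ≤
          -(η ^ 2 / 16) := by
        rw [hlam]
        have a1 : 0 ≤ η ^ 2 * q := by positivity
        have a2 : η ^ 3 ≤ η ^ 2 := pow_le_pow_of_le_one hη0 hη1 (by norm_num)
        nlinarith
      have := mul_le_mul_of_nonneg_right e hw
      linarith
    nlinarith

/-- Joint control of the overlap with `s` and of the weight; the exponent is the binary relative
entropy between `τ` and `p`, up to terms linear in `η`. -/
theorem prob_noiseP_ov_ge_and_wt_le {ρ p τ η : ℝ} (h0 : 0 ≤ ρ) (h1 : ρ ≤ 1) (hp : 0 < p)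
    (hpτ : p < τ) (hτ : τ < 1) (s : BV n) (hs : (wt s : ℝ) ≤ p * n) :
    prob (noiseP ρ) (fun x => (wt x : ℝ) ≤ (1 + η) * (n * ρ) ∧
        (τ - 3 * η) * (n * ρ) ≤ ov s x) ≤
      Real.exp (-(n * ρ * (Real.log (τ / p) * (τ - 3 * η)
        - Real.log ((1 - p) / (1 - τ)) * (1 - τ + 4 * η)))) := by
  set l1 := Real.log (τ / p)
  set l2 := Real.log ((1 - p) / (1 - τ))
  have hl1 : 0 ≤ l1 := Real.log_nonneg (by rw [le_div_iff₀ hp]; linarith)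
  have hl2 : 0 ≤ l2 := Real.log_nonneg (by rw [le_div_iff₀ (by linarith)]; linarith)
  refine (prob_mono (noiseP_nonneg h0 h1) (F := fun x =>
    n * ρ * (l1 * (τ - 3 * η) - l2 * (1 - τ + 4 * η)) ≤
      lin (fun i => if s i then l1 else -l2) x)
    fun x hx => ?_).trans ((prob_noiseP_lin_ge_le h0 h1 _ _).trans (Real.exp_le_exp.2 ?_))
  · have e : lin (fun i => if s i then l1 else -l2) x = (l1 + l2) * ov s x - l2 * wt x := by
      have : (fun i => if s i then l1 else -l2) = fun i => (l1 + l2) * ind s i + (-l2) * 1 := by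
        funext i; unfold ind; split_ifs <;> ring
      rw [this, lin_add, lin_mul, lin_mul, lin_one]
      unfold ov; ring
    rw [e]
    have a1 := mul_le_mul_of_nonneg_left hx.2 (add_nonneg hl1 hl2)
    have a2 := mul_le_mul_of_nonneg_left hx.1 hl2
    nlinarith
  · have hτp : 0 < τ / p := div_pos (by linarith) hp
    have hpp : 0 < (1 - p) / (1 - τ) := div_pos (by linarith) (by linarith)
    have hsum : ∑ i, (Real.exp (if s i then l1 else -l2) - 1) ≤ 0 := by
      have : ∀ i, Real.exp (if s i then l1 else -l2) - 1 =
          if s i then (τ - p) / p else -(τ - p) / (1 - p) := fun i => by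
        split_ifs
        · rw [Real.exp_log hτp]; field_simp
        · rw [Real.exp_neg, Real.exp_log hpp]
          have : 1 - p ≠ 0 := by linarith
          have : 1 - τ ≠ 0 := by linarith
          field_simp; ring
      simp only [this]
      rw [sum_if_eq]
      have hp1 : 0 < 1 - p := by linarith
      have : (wt s : ℝ) * ((τ - p) / p) + (n - wt s) * (-(τ - p) / (1 - p)) =
          (τ - p) / (p * (1 - p)) * (wt s - p * n) := by field_simp; ring
      rw [this]
      exact mul_nonpos_of_nonneg_of_nonpos (div_nonneg (by linarith) (by positivity))
        (by linarith)
    have := mul_nonpos_of_nonneg_of_nonpos h0 hsum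
    linarith

theorem noiseP_vxor {q : ℝ} (hq0 : 0 < q) (hq1 : q < 1) (z x : BV n) :
    noiseP q (vxor z x) = noiseP q z * Real.exp (llr q * lin (sgn z) x) := by
  rw [← lin_mul]
  unfold noiseP lin
  rw [Real.exp_sum, ← Finset.prod_mul_distrib]
  refine Finset.prod_congr rfl fun i _ => ?_
  have hr : 0 < (1 - q) / q := div_pos (by linarith) hq0
  have h1q : 1 - q ≠ 0 := by linarith
  rcases hz : z i <;> rcases hx : x i <;>
    simp [vxor, sgn, llr, hx, hz, Real.exp_neg, Real.exp_log hr] <;> field_simp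

theorem sum_noiseP_mul_noiseP_vxor (ρ q : ℝ) (z : BV n) :
    ∑ x, noiseP ρ x * noiseP q (vxor z x) = noiseP (q + ρ * (1 - 2 * q)) z := by
  have h := sum_noiseP_mul_prod ρ (fun i b => if Bool.xor (z i) b then q else 1 - q)
  rw [show (∑ x, noiseP ρ x * noiseP q (vxor z x)) = _ from h]
  unfold noiseP
  refine Finset.prod_congr rfl fun i _ => ?_
  cases z i <;> simp <;> ring

/-- Given James' observation `z`, each coordinate of the input is one with posterior probability
at most `ρ (1 - q) / q`, so the overlap with any fixed `s` is small. -/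
theorem sum_noiseP_ov_gt_mul_le {ρ q : ℝ} (h0 : 0 ≤ ρ) (h1 : ρ ≤ 1) (hq0 : 0 < q)
    (hq2 : q ≤ 1 / 2) (z s : BV n) {lam : ℝ} (hlam : 0 ≤ lam) (T : ℝ) :
    ∑ x, noiseP ρ x * (noiseP q (vxor z x) * if T < ov s x then 1 else 0) ≤
      noiseP (q + ρ * (1 - 2 * q)) z *
        Real.exp (wt s * (ρ * ((1 - q) / q)) * (Real.exp lam - 1) - lam * T) := by
  have hq1 : q < 1 := by linarith
  have hr : 1 ≤ (1 - q) / q := by rw [le_div_iff₀ hq0]; linarith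
  have he1 : 0 ≤ Real.exp lam - 1 := by linarith [Real.one_le_exp hlam]
  have hnz : 0 ≤ noiseP q z := noiseP_nonneg hq0.le hq1.le z
  have factor : ∀ i, 1 + ρ * (Real.exp (llr q * sgn z i + lam * ind s i) - 1) ≤
      (1 + ρ * (Real.exp (llr q * sgn z i) - 1)) *
        Real.exp (ind s i * (ρ * ((1 - q) / q) * (Real.exp lam - 1))) := by
    intro i
    unfold ind
    split_ifs with hs
    · set L := Real.exp (llr q * sgn z i) with hL
      have hL0 : 0 < L := Real.exp_pos _
      have hpost : ρ * L ≤ (1 + ρ * (L - 1)) * (ρ * ((1 - q) / q)) := by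
        unfold sgn llr at hL
        split_ifs at hL
        · rw [mul_one, Real.exp_log (by linarith)] at hL
          rw [← hL]
          have : 0 ≤ ρ * (L - 1) := mul_nonneg h0 (by linarith)
          nlinarith [mul_nonneg h0 hL0.le]
        · rw [mul_neg_one, Real.exp_neg, Real.exp_log (by linarith)] at hL
          have hL1 : L ≤ 1 := by rw [hL]; exact inv_le_one_of_one_le₀ hr
          have a1 : L ≤ 1 + ρ * (L - 1) := by nlinarith
          have a2 : (1 + ρ * (L - 1)) * ρ ≤ (1 + ρ * (L - 1)) * (ρ * ((1 - q) / q)) :=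
            mul_le_mul_of_nonneg_left (le_mul_of_one_le_right h0 hr) (by linarith)
          nlinarith
      rw [mul_one, one_mul, Real.exp_add, ← hL]
      have hpos : 0 ≤ 1 + ρ * (L - 1) := by nlinarith
      have hexp := Real.add_one_le_exp (ρ * ((1 - q) / q) * (Real.exp lam - 1))
      have a3 := mul_le_mul_of_nonneg_left hexp hpos
      have a4 := mul_le_mul_of_nonneg_right hpost he1
      nlinarith
    · simp
  calc ∑ x, noiseP ρ x * (noiseP q (vxor z x) * if T < ov s x then 1 else 0)
      ≤ ∑ x, noiseP q z * Real.exp (-(lam * T)) *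
          (noiseP ρ x * Real.exp (lin (fun i => llr q * sgn z i + lam * ind s i) x)) := by
        refine Finset.sum_le_sum fun x _ => ?_
        rw [lin_add, lin_mul, lin_mul, noiseP_vxor hq0 hq1]
        have hx := noiseP_nonneg h0 h1 x
        have : (if T < ov s x then (1 : ℝ) else 0) ≤
            Real.exp (-(lam * T)) * Real.exp (lam * lin (ind s) x) := by
          rw [← Real.exp_add]
          split_ifs with h
          · refine Real.one_le_exp ?_
            have := mul_le_mul_of_nonneg_left h.le hlam
            unfold ov at this
            linarith
          · exact Real.exp_nonneg _
        have hc : 0 ≤ noiseP ρ x * (noiseP q z * Real.exp (llr q * lin (sgn z) x)) := by positivity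
        have := mul_le_mul_of_nonneg_left this hc
        rw [Real.exp_add]
        linarith
    _ = noiseP q z * Real.exp (-(lam * T)) *
          ∏ i, (1 + ρ * (Real.exp (llr q * sgn z i + lam * ind s i) - 1)) := by
        rw [← Finset.mul_sum, sum_noiseP_mul_exp_lin]
    _ ≤ noiseP q z * Real.exp (-(lam * T)) *
          ∏ i, ((1 + ρ * (Real.exp (llr q * sgn z i) - 1)) *
            Real.exp (ind s i * (ρ * ((1 - q) / q) * (Real.exp lam - 1)))) := by
        refine mul_le_mul_of_nonneg_left ?_ (by positivity)
        refine Finset.prod_le_prod (fun i _ => ?_) fun i _ => factor i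
        nlinarith [mul_nonneg h0 (Real.exp_nonneg (llr q * sgn z i + lam * ind s i))]
    _ = (noiseP q z * ∏ i, (1 + ρ * (Real.exp (llr q * sgn z i) - 1))) *
          Real.exp (wt s * (ρ * ((1 - q) / q)) * (Real.exp lam - 1) - lam * T) := by
        rw [Finset.prod_mul_distrib, ← Real.exp_sum, ← Finset.sum_mul, sum_ind,
          sub_eq_add_neg (_ * _) (lam * T), Real.exp_add, mul_assoc (wt s : ℝ)]
        ring
    _ = _ := by
        rw [← sum_noiseP_mul_exp_lin, ← sum_noiseP_mul_noiseP_vxor, Finset.mul_sum]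
        congr 1
        refine Finset.sum_congr rfl fun x _ => ?_
        rw [lin_mul, noiseP_vxor hq0 hq1]
        ring

end BernoulliVectors

section RandomCoding

variable {n N Δ : ℕ}

/-- Fraction of Alice's ones that James, blind to her codeword, flips on average. -/
noncomputable def jamFrac (p q : ℝ) : ℝ := p * (1 - q) / q

/-- The weight of `x` is within a relative distance `η` of `w`. -/
def Typical (w η : ℝ) (x : BV n) : Prop := |(wt x : ℝ) - w| ≤ η * w

/-- The observation `z` does not carry more information about `x` than expected. -/
def Plausible (q w η : ℝ) (z x : BV n) : Prop := lin (sgn z) x ≤ (1 - 2 * q + 2 * η) * w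

open scoped Classical in
/-- Deterministic properties of a keyed codebook that make it reliable and covert. -/
structure GoodBook (p q ρ η : ℝ) (c : BV Δ → Fin N → BV n) : Prop where
  typical : ∀ k m, Typical (n * ρ) η (c k m)
  separated : ∀ k m m', m ≠ m' → ov (c k m) (c k m') ≤ η * (n * ρ)
  resolvable : ∀ k z, ∑ m, (if Plausible q (n * ρ) η z (c k m) then
      noiseP q (vxor z (c k m)) else 0) ≤
    N * ((1 + 4 * η) * noiseP (q + ρ * (1 - 2 * q)) z + η * noiseP q z)
  myopic : ∀ k z s, (wt s : ℝ) ≤ p * n →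
    ∑ m, (if Plausible q (n * ρ) η z (c k m) ∧ (jamFrac p q + η) * (n * ρ) < ov s (c k m) then
      noiseP q (vxor z (c k m)) else 0) ≤
    N * (η * noiseP (q + ρ * (1 - 2 * q)) z + η * noiseP q z)
  keyed : ∀ s, (wt s : ℝ) ≤ p * n →
    ∑ k, (if ∃ m, (1 - jamFrac p q - 3 * η) * (n * ρ) ≤ ov s (c k m) then (1 : ℝ) else 0) ≤
      η * 2 ^ Δ

open scoped Classical in
/-- The Bernoulli distribution conditioned on typical vectors. -/
noncomputable def typDist (ρ η : ℝ) (x : BV n) : ℝ :=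
  if Typical (n * ρ) η x then noiseP ρ x / prob (noiseP ρ) (Typical (n := n) (n * ρ) η) else 0

theorem isDist_typDist {ρ η : ℝ} (h0 : 0 ≤ ρ) (h1 : ρ ≤ 1)
    (hT : 0 < prob (noiseP ρ) (Typical (n := n) (n * ρ) η)) :
    IsDist (typDist ρ η : BV n → ℝ) where
  nonneg x := by
    unfold typDist
    split_ifs
    · exact div_nonneg (noiseP_nonneg h0 h1 x) hT.le
    · rfl
  sum_one := by
    classical
    have : ∀ x : BV n, typDist ρ η x = (if Typical (n * ρ) η x then noiseP ρ x else 0) /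
        prob (noiseP ρ) (Typical (n := n) (n * ρ) η) := fun x => by
      unfold typDist; split_ifs <;> simp
    rw [Finset.sum_congr rfl fun x _ => this x, ← Finset.sum_div]
    convert div_self hT.ne'
    unfold prob
    exact Finset.sum_congr rfl fun x _ => by congr

theorem sum_typDist_mul_le {ρ η : ℝ} (h0 : 0 ≤ ρ) (h1 : ρ ≤ 1)
    (hT : 0 < prob (noiseP ρ) (Typical (n := n) (n * ρ) η)) {f : BV n → ℝ} (hf : ∀ x, 0 ≤ f x) :
    ∑ x, typDist ρ η x * f x ≤
      (∑ x, noiseP ρ x * f x) / prob (noiseP ρ) (Typical (n := n) (n * ρ) η) := by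
  rw [Finset.sum_div]
  refine Finset.sum_le_sum fun x _ => ?_
  have := mul_nonneg (noiseP_nonneg h0 h1 x) (hf x)
  unfold typDist
  split_ifs
  · exact le_of_eq (by ring)
  · rw [zero_mul]; exact div_nonneg this hT.le

theorem prob_typDist_le {ρ η : ℝ} (h0 : 0 ≤ ρ) (h1 : ρ ≤ 1) (E : BV n → Prop) :
    prob (typDist ρ η) E ≤ prob (noiseP ρ) (fun x => Typical (n * ρ) η x ∧ E x) /
      prob (noiseP ρ) (Typical (n := n) (n * ρ) η) := by
  classical
  unfold prob
  rw [Finset.sum_div]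
  refine Finset.sum_le_sum fun x _ => ?_
  have := noiseP_nonneg h0 h1 x
  by_cases hE : E x <;> by_cases ht : Typical (n * ρ) η x <;> simp [typDist, hE, ht, prob]

theorem Typical.wt_le {w η : ℝ} {x : BV n} (h : Typical w η x) : (wt x : ℝ) ≤ (1 + η) * w := by
  have := (abs_le.1 h).2
  linarith

theorem Typical.le_wt {w η : ℝ} {x : BV n} (h : Typical w η x) : (1 - η) * w ≤ wt x := by
  have := (abs_le.1 h).1
  linarith

theorem noiseP_pos {q : ℝ} (hq0 : 0 < q) (hq1 : q < 1) (z : BV n) : 0 < noiseP q z :=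
  Finset.prod_pos fun i _ => by split_ifs <;> linarith

open scoped Classical in
/-- Soft covering: the truncated output mass of a random codebook at `z`, restricted to the
codewords satisfying `E`, does not exceed its mean substantially. -/
theorem prob_softCovering_le {q ρ η μ : ℝ} (hq0 : 0 < q) (hq2 : q < 1 / 2)
    (h0 : 0 ≤ ρ) (h1 : ρ ≤ 1) (hη0 : 0 < η) (hη1 : η ≤ 1)
    (hT : 0 < prob (noiseP ρ) (Typical (n := n) (n * ρ) η)) (z : BV n) (E : BV n → Prop)
    (hμ : ∑ x, noiseP ρ x * (noiseP q (vxor z x) * if E x then 1 else 0) ≤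
      μ * prob (noiseP ρ) (Typical (n := n) (n * ρ) η)) :
    prob (prodDist (typDist ρ η)) (fun b : Fin N → BV n =>
      N * ((1 + η) * μ + η * noiseP q z) <
        ∑ m, if Plausible q (n * ρ) η z (b m) ∧ E (b m) then noiseP q (vxor z (b m)) else 0) ≤
      Real.exp (-(η ^ 2 * N / Real.exp (llr q * ((1 - 2 * q + 2 * η) * (n * ρ))))) := by
  have hq1 : q < 1 := by linarith
  have hz := noiseP_pos hq0 hq1 z
  have hllr : 0 ≤ llr q := Real.log_nonneg (by rw [le_div_iff₀ hq0]; linarith)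
  set f : BV n → ℝ := fun x => if Plausible q (n * ρ) η z x ∧ E x then
    Real.exp (llr q * lin (sgn z) x) else 0 with hf
  have hf0 : ∀ x, 0 ≤ f x := fun x => by
    simp only [hf]; split_ifs; exacts [Real.exp_nonneg _, le_rfl]
  have hfB : ∀ x, f x ≤ Real.exp (llr q * ((1 - 2 * q + 2 * η) * (n * ρ))) := fun x => by
    simp only [hf]; split_ifs with h
    · exact Real.exp_le_exp.2 (mul_le_mul_of_nonneg_left h.1 hllr)
    · exact Real.exp_nonneg _
  have hfz : ∀ x, noiseP q z * f x =
      if Plausible q (n * ρ) η z x ∧ E x then noiseP q (vxor z x) else 0 := fun x => by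
    simp only [hf]; split_ifs
    · rw [noiseP_vxor hq0 hq1]
    · simp
  have hmean : ∑ x, typDist ρ η x * f x ≤ μ / noiseP q z := by
    refine (sum_typDist_mul_le h0 h1 hT hf0).trans ?_
    rw [div_le_div_iff₀ hT hz, Finset.sum_mul]
    refine le_trans (Finset.sum_le_sum fun x _ => ?_) hμ
    rw [mul_assoc, mul_comm (f x), hfz]
    refine mul_le_mul_of_nonneg_left ?_ (noiseP_nonneg h0 h1 x)
    have := (noiseP_pos hq0 hq1 (vxor z x)).le
    by_cases hE : E x
    · simp only [hE, and_true, if_true, mul_one]; split_ifs; exacts [le_rfl, this]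
    · simp [hE]
  have := prob_prodDist_mean_gt_le (ι := Fin N) (isDist_typDist h0 h1 hT) (Real.exp_pos _) hf0 hfB
    hmean hη0.le hη1
  rw [Fintype.card_fin] at this
  refine le_trans (prob_mono (isDist_prodDist (isDist_typDist h0 h1 hT)).nonneg
    fun b hb => ?_) this
  simp only [← hfz, ← Finset.mul_sum] at hb
  have e : (N : ℝ) * ((1 + η) * μ + η * noiseP q z) =
      noiseP q z * (N * ((1 + η) * (μ / noiseP q z) + η)) := by
    field_simp
  rw [e] at hb
  exact lt_of_mul_lt_mul_left hb hz.le

theorem prob_not_separated_le {ρ η lam : ℝ} (h0 : 0 ≤ ρ) (h1 : ρ ≤ 1)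
    (hT : 1 / 2 ≤ prob (noiseP ρ) (Typical (n := n) (n * ρ) η)) (hlam : 0 ≤ lam) :
    prob (prodDist (typDist ρ η)) (fun b : Fin N → BV n =>
      ∃ m : Fin N × Fin N, m.1 ≠ m.2 ∧ η * (n * ρ) < ov (b m.1) (b m.2)) ≤
    N ^ 2 * (2 * Real.exp (ρ * ((1 + η) * (n * ρ) * (Real.exp lam - 1)) -
      lam * (η * (n * ρ)))) := by
  have hT0 : 0 < prob (noiseP ρ) (Typical (n := n) (n * ρ) η) := by linarith
  have hd := isDist_typDist h0 h1 hT0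
  have hprod := isDist_prodDist (ι := Fin N) hd
  refine (prob_exists_le_card_mul hprod.nonneg _ (B := 2 * Real.exp (ρ * ((1 + η) * (n * ρ) *
    (Real.exp lam - 1)) - lam * (η * (n * ρ)))) fun m => ?_).trans (le_of_eq ?_)
  · by_cases hm : m.1 = m.2
    · have : prob (prodDist (typDist ρ η)) (fun b : Fin N → BV n =>
          m.1 ≠ m.2 ∧ η * (n * ρ) < ov (b m.1) (b m.2)) = 0 := by
        simp [prob, hm]
      rw [this]
      positivity
    · refine (prob_mono hprod.nonneg fun b hb => hb.2).trans
        (prob_prodDist_pair_le hd hm (fun x y => η * (n * ρ) < ov x y) fun x hx => ?_)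
      have hxt : Typical (n * ρ) η x := by
        by_contra h
        simp [typDist, h] at hx
      refine (prob_typDist_le h0 h1 _).trans ?_
      rw [div_le_iff₀ hT0]
      refine (prob_mono (noiseP_nonneg h0 h1) (F := fun y => η * (n * ρ) ≤ ov x y)
        fun y hy => hy.2.le).trans ((prob_noiseP_ov_ge_le h0 h1 x hlam _).trans ?_)
      have he : 0 ≤ Real.exp lam - 1 := by linarith [Real.one_le_exp hlam]
      have h2 : Real.exp (ρ * (wt x * (Real.exp lam - 1)) - lam * (η * (n * ρ))) ≤
          Real.exp (ρ * ((1 + η) * (n * ρ) * (Real.exp lam - 1)) - lam * (η * (n * ρ))) := by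
        refine Real.exp_le_exp.2 (sub_le_sub_right (mul_le_mul_of_nonneg_left
          (mul_le_mul_of_nonneg_right hxt.wt_le he) h0) _)
      have h3 := Real.exp_pos (ρ * ((1 + η) * (n * ρ) * (Real.exp lam - 1)) -
        lam * (η * (n * ρ)))
      nlinarith
  · simp [sq]

/-- A fixed jamming vector confuses only few of the independent per-key codebooks. -/
theorem prob_not_keyed_le {p q ρ η : ℝ} (hp : 0 < p) (hpq : p < q) (hq2 : q < 1 / 2)
    (h0 : 0 ≤ ρ) (h1 : ρ ≤ 1) (hη : 0 < η)
    (hT : 1 / 2 ≤ prob (noiseP ρ) (Typical (n := n) (n * ρ) η))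
    (hπ : N * (2 * Real.exp (-(n * ρ * (Real.log ((1 - jamFrac p q) / p) * (1 - jamFrac p q - 3 * η)
        - Real.log ((1 - p) / jamFrac p q) * (jamFrac p q + 4 * η))))) ≤ η / 4)
    (s : BV n) (hs : (wt s : ℝ) ≤ p * n) :
    prob (prodDist (prodDist (typDist ρ η))) (fun c : BV Δ → Fin N → BV n =>
      η * 2 ^ Δ < prob (fun _ => 1) (fun k =>
        ∃ m, (1 - jamFrac p q - 3 * η) * (n * ρ) ≤ ov s (c k m))) ≤
      Real.exp (-(η * 2 ^ Δ / 2)) := by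
  classical
  have hT0 : 0 < prob (noiseP ρ) (Typical (n := n) (n * ρ) η) := by linarith
  have hd := isDist_typDist h0 h1 hT0
  have hprod := isDist_prodDist (ι := Fin N) hd
  have hq0 : 0 < q := hp.trans hpq
  have hβ0 : 0 < jamFrac p q := div_pos (mul_pos hp (by linarith)) hq0
  have hβp : p < 1 - jamFrac p q := by
    have : jamFrac p q < 1 - p := by
      unfold jamFrac
      rw [div_lt_iff₀ hq0]
      linarith
    linarith
  set f : (Fin N → BV n) → ℝ := fun b =>
    if ∃ m, (1 - jamFrac p q - 3 * η) * (n * ρ) ≤ ov s (b m) then 1 else 0 with hf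
  have hmean : ∑ b, prodDist (typDist ρ η) b * f b ≤ η / 4 := by
    have e : ∑ b, prodDist (typDist ρ η) b * f b = prob (prodDist (typDist ρ η))
        (fun b : Fin N → BV n => ∃ m, (1 - jamFrac p q - 3 * η) * (n * ρ) ≤ ov s (b m)) := by
      unfold prob
      exact Finset.sum_congr rfl fun b _ => by simp [hf]
    rw [e]
    refine (prob_exists_le_card_mul hprod.nonneg _ fun m => ?_).trans
      (by rw [Fintype.card_fin]; exact hπ)
    rw [prob_prodDist_coord hd m (fun x => (1 - jamFrac p q - 3 * η) * (n * ρ) ≤ ov s x)]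
    refine (prob_typDist_le h0 h1 _).trans ?_
    rw [div_le_iff₀ hT0]
    have := prob_noiseP_ov_ge_and_wt_le (η := η) h0 h1 hp hβp (by linarith) s hs
    rw [sub_sub_cancel] at this
    refine (prob_mono (noiseP_nonneg h0 h1) fun x hx => ⟨hx.1.wt_le, hx.2⟩).trans (this.trans ?_)
    have h3 := Real.exp_pos (-(n * ρ * (Real.log ((1 - jamFrac p q) / p) *
      (1 - jamFrac p q - 3 * η) - Real.log ((1 - p) / jamFrac p q) * (jamFrac p q + 4 * η))))
    nlinarith
  have := prob_prodDist_sum_ge_le (ι := BV Δ) (T := η * 2 ^ Δ) hprod one_pos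
    (fun b => by simp only [hf]; split_ifs <;> norm_num)
    (fun b => by simp only [hf]; split_ifs <;> norm_num) hmean zero_le_one
  refine (prob_mono (isDist_prodDist hprod).nonneg fun c hc => ?_).trans (this.trans ?_)
  · refine (hc.trans_eq ?_).le
    unfold prob
    exact Finset.sum_congr rfl fun k _ => by simp only [hf]
  · refine Real.exp_le_exp.2 ?_
    have hc : (Fintype.card (BV Δ) : ℝ) = 2 ^ Δ := by simp
    rw [hc]
    have he : Real.exp 1 ≤ 3 := Real.exp_one_lt_three.le
    have : 0 ≤ (2 : ℝ) ^ Δ * η := by positivity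
    nlinarith

theorem exists_goodBook {p q ρ η lamS lamM : ℝ} (hp : 0 < p) (hpq : p < q) (hq2 : q < 1 / 2)
    (h0 : 0 ≤ ρ) (h1 : ρ ≤ 1) (hη0 : 0 < η) (hη2 : η ≤ 1 / 2)
    (hlamS : 0 ≤ lamS) (hlamM : 0 ≤ lamM)
    (hTyp : 2 * Real.exp (-(η ^ 2 * (n * ρ) / 4)) ≤ η)
    (hMyo : 3 * Real.exp (n * ρ * (jamFrac p q * (Real.exp lamM - 1)) -
      lamM * ((jamFrac p q + η) * (n * ρ))) ≤ η)
    (hSep : 2 ^ Δ * (N ^ 2 * (2 * Real.exp (ρ * ((1 + η) * (n * ρ) * (Real.exp lamS - 1)) -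
      lamS * (η * (n * ρ))))) ≤ 1 / 8)
    (hRes : 2 ^ Δ * (2 ^ n * 2 ^ n * Real.exp (-(η ^ 2 * N /
      Real.exp (llr q * ((1 - 2 * q + 2 * η) * (n * ρ)))))) ≤ 1 / 8)
    (hπ : N * (2 * Real.exp (-(n * ρ * (Real.log ((1 - jamFrac p q) / p) * (1 - jamFrac p q - 3 * η)
        - Real.log ((1 - p) / jamFrac p q) * (jamFrac p q + 4 * η))))) ≤ η / 4)
    (hKey : 2 ^ n * Real.exp (-(η * 2 ^ Δ / 2)) ≤ 1 / 8) :
    ∃ c : BV Δ → Fin N → BV n, GoodBook p q ρ η c := by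
  classical
  have hq0 : 0 < q := hp.trans hpq
  have hT1 : 1 - η ≤ prob (noiseP ρ) (Typical (n := n) (n * ρ) η) := by
    have e := prob_add_prob_not (noiseP ρ) (Typical (n := n) (n * ρ) η)
    rw [(isDist_noiseP h0 h1).sum_one] at e
    have := prob_noiseP_not_typical_le (n := n) h0 h1 hη0.le (by linarith)
    unfold Typical at e ⊢
    linarith
  set PT := prob (noiseP ρ) (Typical (n := n) (n * ρ) η)
  have hT : 1 / 2 ≤ PT := by linarith
  have hT0 : 0 < PT := by linarith
  have hd := isDist_typDist h0 h1 hT0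
  have hprod := isDist_prodDist (ι := Fin N) hd
  have hprod2 := isDist_prodDist (ι := BV Δ) hprod
  have hratio : (1 + η) / PT ≤ 1 + 4 * η := by
    rw [div_le_iff₀ hT0]
    nlinarith
  set bnd := Real.exp (-(η ^ 2 * N / Real.exp (llr q * ((1 - 2 * q + 2 * η) * (n * ρ))))) with hbnd
  have hq'z : ∀ z : BV n, 0 ≤ noiseP (q + ρ * (1 - 2 * q)) z := fun z =>
    noiseP_nonneg (by nlinarith) (by nlinarith) z
  have cardBV : ∀ l : ℕ, (Fintype.card (BV l) : ℝ) = 2 ^ l := fun l => by simp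
  let ES : (Fin N → BV n) → Prop := fun b =>
    ∃ m : Fin N × Fin N, m.1 ≠ m.2 ∧ η * (n * ρ) < ov (b m.1) (b m.2)
  let ER : (Fin N → BV n) → Prop := fun b => ∃ z : BV n,
    N * ((1 + 4 * η) * noiseP (q + ρ * (1 - 2 * q)) z + η * noiseP q z) <
    ∑ m, (if Plausible q (n * ρ) η z (b m) then noiseP q (vxor z (b m)) else 0)
  let EM : (Fin N → BV n) → Prop := fun b => ∃ zs : BV n × BV n, (wt zs.2 : ℝ) ≤ p * n ∧
    N * (η * noiseP (q + ρ * (1 - 2 * q)) zs.1 + η * noiseP q zs.1) <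
    ∑ m, (if Plausible q (n * ρ) η zs.1 (b m) ∧ (jamFrac p q + η) * (n * ρ) < ov zs.2 (b m) then
      noiseP q (vxor zs.1 (b m)) else 0)
  let EK : (BV Δ → Fin N → BV n) → Prop := fun c => ∃ s : BV n, (wt s : ℝ) ≤ p * n ∧
    η * 2 ^ Δ < prob (fun _ => 1) (fun k =>
        ∃ m, (1 - jamFrac p q - 3 * η) * (n * ρ) ≤ ov s (c k m))
  have hES : prob (prodDist (typDist ρ η)) ES ≤ _ := prob_not_separated_le h0 h1 hT hlamS
  have hER : prob (prodDist (typDist ρ η)) ER ≤ 2 ^ n * 2 ^ n * bnd := by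
    refine (prob_exists_le_card_mul hprod.nonneg _ (B := bnd) fun z => ?_).trans ?_
    · refine (prob_mono hprod.nonneg fun b hb => ?_).trans
        (prob_softCovering_le (μ := noiseP (q + ρ * (1 - 2 * q)) z / PT) hq0 hq2 h0 h1 hη0
          (by linarith) hT0 z (fun _ => True) ?_)
      · refine lt_of_le_of_lt ?_ (hb.trans_eq ?_)
        · refine mul_le_mul_of_nonneg_left (add_le_add_left ?_ _) (Nat.cast_nonneg N)
          rw [← mul_div_assoc, mul_div_right_comm]
          exact mul_le_mul_of_nonneg_right hratio (hq'z z)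
        · simp
      · rw [div_mul_cancel₀ _ hT0.ne']
        simp [sum_noiseP_mul_noiseP_vxor]
    · rw [cardBV, mul_assoc]
      refine mul_le_mul_of_nonneg_left ?_ (by positivity)
      exact le_mul_of_one_le_left (Real.exp_nonneg _) (one_le_pow₀ (by norm_num))
  have hEM : prob (prodDist (typDist ρ η)) EM ≤ 2 ^ n * 2 ^ n * bnd := by
    refine (prob_exists_le_card_mul hprod.nonneg _ (B := bnd) fun zs => ?_).trans (le_of_eq ?_)
    · obtain ⟨z, s⟩ := zs
      by_cases hs : (wt s : ℝ) ≤ p * n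
      · set ex := Real.exp (n * ρ * (jamFrac p q * (Real.exp lamM - 1)) -
          lamM * ((jamFrac p q + η) * (n * ρ))) with hex
        have hex0 : 0 < ex := Real.exp_pos _
        refine (prob_mono hprod.nonneg fun b hb => ?_).trans
          (prob_softCovering_le (μ := noiseP (q + ρ * (1 - 2 * q)) z * ex / PT) hq0 hq2 h0 h1 hη0
            (by linarith) hT0 z (fun x => (jamFrac p q + η) * (n * ρ) < ov s x) ?_)
        · refine lt_of_le_of_lt ?_ hb.2
          refine mul_le_mul_of_nonneg_left (add_le_add_left ?_ _) (Nat.cast_nonneg N)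
          rw [← mul_div_assoc, mul_div_right_comm, mul_comm _ ex, ← mul_assoc]
          refine mul_le_mul_of_nonneg_right ?_ (hq'z z)
          have : (1 + η) / PT ≤ 3 := by linarith
          nlinarith
        · rw [div_mul_cancel₀ _ hT0.ne']
          refine (sum_noiseP_ov_gt_mul_le h0 h1 hq0 hq2.le z s hlamM _).trans ?_
          refine mul_le_mul_of_nonneg_left (Real.exp_le_exp.2 (sub_le_sub_right ?_ _)) (hq'z z)
          have he : 0 ≤ ρ * ((1 - q) / q) * (Real.exp lamM - 1) :=
            mul_nonneg (mul_nonneg h0 (div_nonneg (by linarith) hq0.le))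
              (by linarith [Real.one_le_exp hlamM])
          calc (wt s : ℝ) * (ρ * ((1 - q) / q)) * (Real.exp lamM - 1)
              = wt s * (ρ * ((1 - q) / q) * (Real.exp lamM - 1)) := by ring
            _ ≤ (p * n) * (ρ * ((1 - q) / q) * (Real.exp lamM - 1)) :=
              mul_le_mul_of_nonneg_right hs he
            _ = _ := by unfold jamFrac; ring
      · have : ∀ b : Fin N → BV n, ¬ ((wt s : ℝ) ≤ p * n ∧
            N * (η * noiseP (q + ρ * (1 - 2 * q)) z + η * noiseP q z) <
            ∑ m, (if Plausible q (n * ρ) η z (b m) ∧ (jamFrac p q + η) * (n * ρ) < ov s (b m) then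
              noiseP q (vxor z (b m)) else 0)) := fun b hb => hs hb.1
        have h0 : prob (prodDist (typDist ρ η)) (fun b : Fin N → BV n => (wt s : ℝ) ≤ p * n ∧
            N * (η * noiseP (q + ρ * (1 - 2 * q)) z + η * noiseP q z) <
            ∑ m, (if Plausible q (n * ρ) η z (b m) ∧ (jamFrac p q + η) * (n * ρ) < ov s (b m) then
              noiseP q (vxor z (b m)) else 0)) = 0 := by
          unfold prob
          exact Finset.sum_eq_zero fun b _ => if_neg (this b)
        exact h0.le.trans (Real.exp_nonneg _)
    · rw [Fintype.card_prod, Nat.cast_mul, cardBV]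
  have hEK : prob (prodDist (prodDist (typDist ρ η))) EK ≤
      2 ^ n * Real.exp (-(η * 2 ^ Δ / 2)) := by
    refine (prob_exists_le_card_mul hprod2.nonneg _ fun s => ?_).trans_eq (by rw [cardBV])
    by_cases hs : (wt s : ℝ) ≤ p * n
    · exact (prob_mono hprod2.nonneg fun c hc => hc.2).trans
        (prob_not_keyed_le hp hpq hq2 h0 h1 hη0 hT hπ s hs)
    · have : prob (prodDist (prodDist (typDist ρ η))) (fun c : BV Δ → Fin N → BV n =>
          (wt s : ℝ) ≤ p * n ∧ η * 2 ^ Δ < prob (fun _ => 1) (fun k =>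
            ∃ m, (1 - jamFrac p q - 3 * η) * (n * ρ) ≤ ov s (c k m))) = 0 := by
        unfold prob
        exact Finset.sum_eq_zero fun b _ => if_neg fun h => hs h.1
      exact this.le.trans (Real.exp_nonneg _)
  have perKey : ∀ (E : (Fin N → BV n) → Prop) (B : ℝ), prob (prodDist (typDist ρ η)) E ≤ B →
      prob (prodDist (prodDist (typDist ρ η))) (fun c : BV Δ → Fin N → BV n => ∃ k, E (c k)) ≤
        2 ^ Δ * B := fun E B hB => by
    refine (prob_exists_le_card_mul hprod2.nonneg _ fun k => ?_).trans_eq (by rw [cardBV])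
    rw [prob_prodDist_coord hprod k E]
    exact hB
  have htotal : prob (prodDist (prodDist (typDist ρ η))) (fun c : BV Δ → Fin N → BV n =>
      (∃ k, ES (c k)) ∨ (∃ k, ER (c k)) ∨ (∃ k, EM (c k)) ∨ EK c) < 1 := by
    have a1 := perKey ES _ hES
    have a2 := perKey ER _ hER
    have a3 := perKey EM _ hEM
    have b1 := prob_or_le hprod2.nonneg (fun c : BV Δ → Fin N → BV n => ∃ k, ES (c k))
      (fun c => (∃ k, ER (c k)) ∨ (∃ k, EM (c k)) ∨ EK c)
    have b2 := prob_or_le hprod2.nonneg (fun c : BV Δ → Fin N → BV n => ∃ k, ER (c k))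
      (fun c => (∃ k, EM (c k)) ∨ EK c)
    have b3 := prob_or_le hprod2.nonneg (fun c : BV Δ → Fin N → BV n => ∃ k, EM (c k)) EK
    linarith
  obtain ⟨c, hcpos, hc⟩ := exists_not_of_prob_lt_one hprod2 htotal
  simp only [not_or] at hc
  obtain ⟨cS, cR, cM, cK⟩ := hc
  simp only [ES, ER, EM, EK, not_exists, not_and, not_lt] at cS cR cM cK
  refine ⟨c, ⟨fun k m => ?_, fun k m m' h => cS k (m, m') h, fun k z => ?_, fun k z s hs => ?_,
    fun s hs => ?_⟩⟩
  · by_contra h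
    refine hcpos.ne' ?_
    unfold prodDist
    refine Finset.prod_eq_zero (Finset.mem_univ k) (Finset.prod_eq_zero (Finset.mem_univ m) ?_)
    simp [typDist, h]
  · convert cR k z
  · convert cM k (z, s) hs
  · by_contra hcon
    rw [not_le] at hcon
    refine absurd (cK s hs) (not_le.2 (hcon.trans_eq ?_))
    unfold prob
    congr!

end RandomCoding

section Analysis

variable {n N Δ : ℕ}

open scoped Classical in
/-- The code with codebook `c` and the threshold decoder that counts the positions where the
received word and a codeword are both one. -/
noncomputable def bookCode (c : BV Δ → Fin N → BV n) (thr : ℝ) : Code n N Δ where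
  enc m k := c k m
  dec y k := if h : ∃ m, thr ≤ ov y (c k m) ∧ ∀ m', thr ≤ ov y (c k m') → m' = m then
    some h.choose else none

theorem bookCode_dec_eq_some {c : BV Δ → Fin N → BV n} {thr : ℝ} {y : BV n} {k : BV Δ} {m : Fin N}
    (hm : thr ≤ ov y (c k m)) (hu : ∀ m', thr ≤ ov y (c k m') → m' = m) :
    (bookCode c thr).dec y k = some m := by
  have h : ∃ m, thr ≤ ov y (c k m) ∧ ∀ m', thr ≤ ov y (c k m') → m' = m := ⟨m, hm, hu⟩
  simp only [bookCode, dif_pos h, Option.some.injEq]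
  exact hu _ h.choose_spec.1

theorem bookCode_dec_eq_none {c : BV Δ → Fin N → BV n} {thr : ℝ} {y : BV n} {k : BV Δ}
    (h : ∀ m, ov y (c k m) < thr) : (bookCode c thr).dec y k = none := by
  simp only [bookCode]
  rw [dif_neg]
  rintro ⟨m, hm, -⟩
  exact absurd (h m) (not_lt.2 hm)

theorem Jammer.sum_mul_le {p : ℝ} (J : Jammer n p) (z : BV n) {f : BV n → ℝ} {B : ℝ}
    (hf : ∀ s : BV n, (wt s : ℝ) ≤ p * n → f s ≤ B) : ∑ s, J.W z s * f s ≤ B := by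
  calc ∑ s, J.W z s * f s ≤ ∑ s, J.W z s * B := by
        refine Finset.sum_le_sum fun s _ => ?_
        by_cases h : J.W z s = 0
        · simp [h]
        · exact mul_le_mul_of_nonneg_left (hf s (J.wt_le z s h)) (J.nonneg z s)
    _ = B := by rw [← Finset.sum_mul, J.sum_one, one_mul]

variable {p q ρ η : ℝ} {c : BV Δ → Fin N → BV n}

theorem GoodBook.fail_imp (hG : GoodBook p q ρ η c) {k : BV Δ} {m : Fin N} {s : BV n}
    (h : (bookCode c ((1 - jamFrac p q - 2 * η) * (n * ρ))).dec (vxor (c k m) s) k ≠ some m) :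
    (jamFrac p q + η) * (n * ρ) < ov s (c k m) ∨
      ∃ m, (1 - jamFrac p q - 3 * η) * (n * ρ) ≤ ov s (c k m) := by
  by_contra hcon
  rw [not_or, not_lt, not_exists] at hcon
  refine h (bookCode_dec_eq_some ?_ fun m' hm' => ?_)
  · rw [ov_vxor_self]
    have := (hG.typical k m).le_wt
    linarith [hcon.1]
  · by_contra hne
    have h1 := hG.separated k m m' (Ne.symm hne)
    have h2 := ov_vxor_le (c k m) s (c k m')
    have h3 := hcon.2 m'
    rw [not_le] at h3
    linarith

theorem GoodBook.errSilent_le (hG : GoodBook p q ρ η c) (hq0 : 0 < q) (hq1 : q < 1)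
    (hw : 0 ≤ η * (n * ρ)) (J : Jammer n p) :
    errSilent q (bookCode c ((1 - jamFrac p q - 2 * η) * (n * ρ))) J ≤ η := by
  classical
  unfold errSilent
  rw [one_div, inv_mul_le_iff₀ (by positivity), Finset.sum_comm]
  have : ∀ zb : BV n, ∑ k : BV Δ, noiseP q zb * ∑ s : BV n, J.W zb s *
      (if (bookCode c ((1 - jamFrac p q - 2 * η) * (n * ρ))).dec s k = Option.none
        then (0 : ℝ) else 1) ≤ noiseP q zb * (η * 2 ^ Δ) := fun zb => by
    rw [← Finset.mul_sum, Finset.sum_comm]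
    refine mul_le_mul_of_nonneg_left ?_ (noiseP_pos hq0 hq1 zb).le
    simp_rw [← Finset.mul_sum]
    refine J.sum_mul_le zb fun s hs => le_trans (Finset.sum_le_sum fun k _ => ?_) (hG.keyed s hs)
    split_ifs with h1 h2 h2
    · exact zero_le_one
    · rfl
    · rfl
    · refine absurd (bookCode_dec_eq_none fun m => ?_) h1
      rw [not_exists] at h2
      have := h2 m
      rw [not_le] at this
      linarith
  refine (Finset.sum_le_sum fun zb _ => this zb).trans (le_of_eq ?_)
  rw [← Finset.sum_mul, (isDist_noiseP hq0.le hq1.le).sum_one]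
  ring

open scoped Classical in
theorem GoodBook.sum_not_plausible_le (hG : GoodBook p q ρ η c) (hq0 : 0 < q) (hq2 : q < 1 / 2)
    (hη0 : 0 < η) (hη1 : η ≤ 1) (hw : 0 ≤ n * ρ)
    (hε : Real.exp (-(η ^ 2 * (n * ρ) / 16)) ≤ η) (k : BV Δ) (m : Fin N) :
    ∑ z, (if Plausible q (n * ρ) η z (c k m) then 0 else noiseP q (vxor z (c k m))) ≤ η := by
  refine le_trans (le_of_eq ?_) ((prob_noiseP_sgn_gt_le hq0.le hq2.le hη0.le hη1 hw (c k m)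
    (hG.typical k m).wt_le).trans hε)
  rw [← sum_vxor (c k m)]
  unfold prob Plausible
  refine Finset.sum_congr rfl fun z _ => ?_
  rw [vxor_comm (vxor (c k m) z), vxor_vxor_cancel]
  by_cases h : lin (sgn (vxor (c k m) z)) (c k m) ≤ (1 - 2 * q + 2 * η) * (n * ρ)
  · rw [if_pos h, if_neg (not_lt.2 h)]
  · rw [if_neg h, if_pos (not_le.1 h)]

theorem sum_mixture {q' : ℝ} (h0 : 0 ≤ q) (h1 : q ≤ 1) (h0' : 0 ≤ q') (h1' : q' ≤ 1) (a b : ℝ) :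
    ∑ z : BV n, (a * noiseP q' z + b * noiseP q z) = a + b := by
  rw [Finset.sum_add_distrib, ← Finset.mul_sum, ← Finset.mul_sum, (isDist_noiseP h0 h1).sum_one,
    (isDist_noiseP h0' h1').sum_one, mul_one, mul_one]

theorem errActive_eq (c : BV Δ → Fin N → BV n) (thr : ℝ) (J : Jammer n p) :
    errActive q (bookCode c thr) J = (1 / ((N : ℝ) * 2 ^ Δ)) * ∑ z : BV n, ∑ s : BV n, J.W z s *
      ∑ k, ∑ m, noiseP q (vxor z (c k m)) *
        (if (bookCode c thr).dec (vxor (c k m) s) k = some m then (0 : ℝ) else 1) := by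
  unfold errActive
  congr 1
  have : ∀ (m : Fin N) (k : BV Δ), ∑ zb : BV n,
      noiseP q zb * ∑ s : BV n, J.W (vxor ((bookCode c thr).enc m k) zb) s *
      (if (bookCode c thr).dec (vxor ((bookCode c thr).enc m k) s) k = some m then (0 : ℝ) else 1) =
      ∑ z : BV n, ∑ s : BV n, J.W z s * (noiseP q (vxor z (c k m)) *
        (if (bookCode c thr).dec (vxor (c k m) s) k = some m then (0 : ℝ) else 1)) := fun m k => by
    rw [← sum_vxor (c k m)]
    refine Finset.sum_congr rfl fun z _ => ?_
    rw [Finset.mul_sum]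
    refine Finset.sum_congr rfl fun s _ => ?_
    have e : (bookCode c thr).enc m k = c k m := rfl
    rw [e, vxor_vxor_cancel, vxor_comm z]
    ring
  simp_rw [this, Finset.mul_sum]
  calc _ = ∑ m : Fin N, ∑ z : BV n, ∑ k : BV Δ, ∑ s : BV n, _ :=
        Finset.sum_congr rfl fun m _ => Finset.sum_comm
    _ = ∑ z : BV n, ∑ m : Fin N, ∑ k : BV Δ, ∑ s : BV n, _ := Finset.sum_comm
    _ = ∑ z : BV n, ∑ k : BV Δ, ∑ m : Fin N, ∑ s : BV n, _ :=
        Finset.sum_congr rfl fun z _ => Finset.sum_comm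
    _ = ∑ z : BV n, ∑ k : BV Δ, ∑ s : BV n, ∑ m : Fin N, _ :=
        Finset.sum_congr rfl fun z _ => Finset.sum_congr rfl fun k _ => Finset.sum_comm
    _ = ∑ z : BV n, ∑ s : BV n, ∑ k : BV Δ, ∑ m : Fin N, _ :=
        Finset.sum_congr rfl fun z _ => Finset.sum_comm

theorem GoodBook.errActive_le (hG : GoodBook p q ρ η c) (hN : 0 < N) (hq0 : 0 < q)
    (hq2 : q < 1 / 2) (h0 : 0 ≤ ρ) (h1 : ρ ≤ 1) (hη0 : 0 < η) (hη1 : η ≤ 1 / 2)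
    (hε : Real.exp (-(η ^ 2 * (n * ρ) / 16)) ≤ η) (J : Jammer n p) :
    errActive q (bookCode c ((1 - jamFrac p q - 2 * η) * (n * ρ))) J ≤ 7 * η := by
  classical
  have hw : 0 ≤ n * ρ := by positivity
  have hN' : (0 : ℝ) < N := Nat.cast_pos.2 hN
  set thr := (1 - jamFrac p q - 2 * η) * (n * ρ) with hthr
  set q' := q + ρ * (1 - 2 * q) with hq'
  have hq'0 : 0 ≤ q' := by rw [hq']; nlinarith
  have hq'1 : q' ≤ 1 := by rw [hq']; nlinarith
  rw [errActive_eq, one_div, inv_mul_le_iff₀ (by positivity)]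
  let U : BV n → ℝ := fun z => ∑ k, ∑ m,
    (if Plausible q (n * ρ) η z (c k m) then 0 else noiseP q (vxor z (c k m)))
  have hU : ∑ z, U z ≤ 2 ^ Δ * (N * η) := by
    simp only [U]
    rw [Finset.sum_comm]
    calc _ ≤ ∑ k : BV Δ, (N : ℝ) * η := Finset.sum_le_sum fun k _ => by
          rw [Finset.sum_comm]
          calc _ ≤ ∑ m : Fin N, η := Finset.sum_le_sum fun m _ =>
                hG.sum_not_plausible_le hq0 hq2 hη0 (by linarith) hw hε k m
            _ = N * η := by simp
      _ = 2 ^ Δ * (N * η) := by simp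
  have key : ∀ z s : BV n, (wt s : ℝ) ≤ p * n → ∑ k, ∑ m, noiseP q (vxor z (c k m)) *
      (if (bookCode c thr).dec (vxor (c k m) s) k = some m then (0 : ℝ) else 1) ≤
      U z + N * 2 ^ Δ * ((η + η * (1 + 4 * η)) * noiseP q' z + (η + η * η) * noiseP q z) := by
    intro z s hs
    set R := (N : ℝ) * ((1 + 4 * η) * noiseP q' z + η * noiseP q z) with hR
    have hR0 : 0 ≤ R := by
      have := noiseP_nonneg hq'0 hq'1 z
      have := noiseP_nonneg hq0.le (by linarith) z
      positivity
    have hk : ∀ k, ∑ m, noiseP q (vxor z (c k m)) *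
        (if (bookCode c thr).dec (vxor (c k m) s) k = some m then (0 : ℝ) else 1) ≤
        ∑ m, (if Plausible q (n * ρ) η z (c k m) then 0 else noiseP q (vxor z (c k m))) +
        N * (η * noiseP q' z + η * noiseP q z) +
        (if ∃ m, (1 - jamFrac p q - 3 * η) * (n * ρ) ≤ ov s (c k m) then (1 : ℝ) else 0) * R := by
      intro k
      refine le_trans (b := ∑ m, (
        (if Plausible q (n * ρ) η z (c k m) then 0 else noiseP q (vxor z (c k m))) +
        (if Plausible q (n * ρ) η z (c k m) ∧ (jamFrac p q + η) * (n * ρ) < ov s (c k m) then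
          noiseP q (vxor z (c k m)) else 0) +
        (if ∃ m, (1 - jamFrac p q - 3 * η) * (n * ρ) ≤ ov s (c k m) then (1 : ℝ) else 0) *
        (if Plausible q (n * ρ) η z (c k m) then noiseP q (vxor z (c k m)) else 0)))
        (Finset.sum_le_sum fun m _ => ?_) ?_
      · have ha := (noiseP_pos hq0 (by linarith) (vxor z (c k m))).le
        by_cases hF : (bookCode c thr).dec (vxor (c k m) s) k = some m
        · rw [if_pos hF, mul_zero]
          split_ifs <;> simp [ha]
        · rw [if_neg hF, mul_one]
          by_cases hP : Plausible q (n * ρ) η z (c k m)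
          · rcases hG.fail_imp hF with hA | hB
            · simp only [hP, hA, and_self, if_true, zero_add]
              split_ifs <;> simp [ha]
            · simp only [hP, hB, if_true, true_and, zero_add, one_mul]
              split_ifs <;> simp [ha]
          · simp [hP]
      · rw [Finset.sum_add_distrib, Finset.sum_add_distrib, ← Finset.mul_sum]
        refine add_le_add (add_le_add le_rfl (hG.myopic k z s hs))
          (mul_le_mul_of_nonneg_left (hG.resolvable k z) ?_)
        split_ifs <;> norm_num
    refine (Finset.sum_le_sum fun k _ => hk k).trans ?_
    rw [Finset.sum_add_distrib, Finset.sum_add_distrib, ← Finset.sum_mul (f := fun k => if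
      ∃ m, (1 - jamFrac p q - 3 * η) * (n * ρ) ≤ ov s (c k m) then (1 : ℝ) else 0)]
    have := mul_le_mul_of_nonneg_right (hG.keyed s hs) hR0
    have e : ∑ k : BV Δ, (N : ℝ) * (η * noiseP q' z + η * noiseP q z) =
      2 ^ Δ * (N * (η * noiseP q' z + η * noiseP q z)) := by simp
    rw [e]
    refine le_trans (add_le_add le_rfl this) (le_of_eq ?_)
    simp only [U, hR]
    ring
  refine (Finset.sum_le_sum fun z _ => J.sum_mul_le z (key z)).trans ?_
  rw [Finset.sum_add_distrib, ← Finset.mul_sum, sum_mixture hq0.le (by linarith) hq'0 hq'1]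
  have : (0 : ℝ) < N * 2 ^ Δ := by positivity
  nlinarith [mul_pos this hη0, mul_pos (mul_pos this hη0) hη0]

theorem GoodBook.covertGap_ge (hG : GoodBook p q ρ η c) (hN : 0 < N) (hq0 : 0 < q)
    (hq2 : q < 1 / 2) (h0 : 0 ≤ ρ) (h1 : ρ ≤ 1) (hη0 : 0 < η) (hη1 : η ≤ 1)
    (hε : Real.exp (-(η ^ 2 * (n * ρ) / 16)) ≤ η) {D : ℝ}
    (hD : ∀ Φ : BV n → Bool, PFA (q + ρ * (1 - 2 * q)) Φ - PFA q Φ ≤ D) (thr : ℝ) :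
    1 - D - 6 * η ≤ covertGap q (bookCode c thr) := by
  classical
  refine le_ciInf fun Φ => ?_
  have hw : 0 ≤ n * ρ := by positivity
  have hN' : (0 : ℝ) < N := Nat.cast_pos.2 hN
  have hq1 : q ≤ 1 := by linarith
  set q' := q + ρ * (1 - 2 * q) with hq'
  have hq'0 : 0 ≤ q' := by rw [hq']; nlinarith
  have hq'1 : q' ≤ 1 := by rw [hq']; nlinarith
  have hmd : 1 - PMD q (bookCode c thr) Φ = (1 / ((N : ℝ) * 2 ^ Δ)) *
      ∑ k, ∑ m, ∑ z : BV n, noiseP q (vxor z (c k m)) * (if Φ z then (1 : ℝ) else 0) := by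
    have e : ∀ x : BV n, ∑ z : BV n, noiseP q (vxor z x) * (if Φ z then (0 : ℝ) else 1) =
        1 - ∑ z : BV n, noiseP q (vxor z x) * (if Φ z then (1 : ℝ) else 0) := fun x => by
      have : ∑ z : BV n, noiseP q (vxor z x) = 1 := by
        simp_rw [vxor_comm _ x]
        rw [sum_vxor x]
        exact (isDist_noiseP hq0.le hq1).sum_one
      rw [eq_sub_iff_add_eq, ← Finset.sum_add_distrib]
      refine Eq.trans ?_ this
      refine Finset.sum_congr rfl fun z _ => ?_
      split_ifs <;> simp
    unfold PMD
    rw [Finset.sum_comm]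
    have e' : ∀ (k : BV Δ) (m : Fin N), (bookCode c thr).enc m k = c k m := fun _ _ => rfl
    simp_rw [e', e, Finset.sum_sub_distrib]
    simp only [Finset.sum_const, Finset.card_univ, Fintype.card_fin, nsmul_eq_mul, mul_one]
    have hc : ((Fintype.card (BV Δ) : ℕ) : ℝ) = 2 ^ Δ := by simp
    rw [hc]
    field_simp
    ring
  have hub : ∑ k, ∑ m, ∑ z : BV n, noiseP q (vxor z (c k m)) * (if Φ z then (1 : ℝ) else 0) ≤
      N * 2 ^ Δ * (PFA q' Φ + 6 * η) := by
    have hk : ∀ k, ∑ m, ∑ z : BV n, noiseP q (vxor z (c k m)) * (if Φ z then (1 : ℝ) else 0) ≤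
        N * (PFA q' Φ + 6 * η) := by
      intro k
      calc _ ≤ ∑ m, ∑ z : BV n,
            ((if Plausible q (n * ρ) η z (c k m) then 0 else noiseP q (vxor z (c k m))) +
            (if Φ z then (1 : ℝ) else 0) *
            (if Plausible q (n * ρ) η z (c k m) then noiseP q (vxor z (c k m)) else 0)) := by
            refine Finset.sum_le_sum fun m _ => Finset.sum_le_sum fun z _ => ?_
            have ha := (noiseP_pos hq0 (by linarith) (vxor z (c k m))).le
            split_ifs <;> simp [ha]
        _ = ∑ m, ∑ z : BV n,
            (if Plausible q (n * ρ) η z (c k m) then 0 else noiseP q (vxor z (c k m))) +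
            ∑ z : BV n, (if Φ z then (1 : ℝ) else 0) * ∑ m,
            (if Plausible q (n * ρ) η z (c k m) then noiseP q (vxor z (c k m)) else 0) := by
            simp_rw [Finset.sum_add_distrib, Finset.mul_sum]
            rw [Finset.sum_comm (s := univ (α := BV n))]
        _ ≤ ∑ m : Fin N, η + ∑ z : BV n, (N * (noiseP q' z * (if Φ z then (1 : ℝ) else 0)) +
              (N * (4 * η) * noiseP q' z + N * η * noiseP q z)) := by
            refine add_le_add (Finset.sum_le_sum fun m _ =>
              hG.sum_not_plausible_le hq0 hq2 hη0 hη1 hw hε k m)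
              (Finset.sum_le_sum fun z _ => ?_)
            have hr := hG.resolvable k z
            have i1 := noiseP_nonneg hq'0 hq'1 z
            have i2 := noiseP_nonneg hq0.le hq1 z
            split_ifs with hΦ
            · rw [one_mul]
              refine hr.trans (le_of_eq ?_)
              ring
            · simp only [zero_mul, mul_zero, zero_add]
              positivity
        _ = N * (PFA q' Φ + 6 * η) := by
            rw [Finset.sum_add_distrib, ← Finset.mul_sum, sum_mixture hq0.le hq1 hq'0 hq'1]
            simp only [Finset.sum_const, Finset.card_univ, Fintype.card_fin, nsmul_eq_mul]
            unfold PFA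
            ring
    refine (Finset.sum_le_sum fun k _ => hk k).trans (le_of_eq ?_)
    simp
    ring
  have : 1 - PMD q (bookCode c thr) Φ ≤ PFA q' Φ + 6 * η := by
    rw [hmd, one_div, inv_mul_le_iff₀ (by positivity)]
    exact hub
  have := hD Φ
  linarith

theorem nonempty_jammer (hp : 0 ≤ p) : Nonempty (Jammer n p) := by
  classical
  refine ⟨⟨fun _ s => if s = (fun _ => false) then 1 else 0, fun z s => ?_, fun z => by simp,
    fun z s h => ?_⟩⟩
  · split_ifs <;> norm_num
  · have : s = fun _ => false := by
      by_contra hs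
      simp [hs] at h
    subst this
    simp only [wt, Bool.false_eq_true, Finset.filter_false, Finset.card_empty, Nat.cast_zero]
    positivity

theorem Perr_nonneg (hq0 : 0 ≤ q) (hq1 : q ≤ 1) (C : Code n N Δ) : 0 ≤ Perr p q C := by
  refine Real.iSup_nonneg fun J => add_nonneg ?_ ?_
  · refine mul_nonneg (by positivity) (Finset.sum_nonneg fun k _ => Finset.sum_nonneg fun z _ =>
      mul_nonneg (noiseP_nonneg hq0 hq1 z) (Finset.sum_nonneg fun s _ =>
        mul_nonneg (J.nonneg _ _) ?_))
    split_ifs <;> norm_num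
  · refine mul_nonneg (by positivity) (Finset.sum_nonneg fun m _ => Finset.sum_nonneg fun k _ =>
      Finset.sum_nonneg fun z _ => mul_nonneg (noiseP_nonneg hq0 hq1 z) (Finset.sum_nonneg
        fun s _ => mul_nonneg (J.nonneg _ _) ?_))
    split_ifs <;> norm_num

theorem GoodBook.Perr_le (hG : GoodBook p q ρ η c) (hN : 0 < N) (hp : 0 ≤ p) (hq0 : 0 < q)
    (hq2 : q < 1 / 2) (h0 : 0 ≤ ρ) (h1 : ρ ≤ 1) (hη0 : 0 < η) (hη1 : η ≤ 1 / 2)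
    (hε : Real.exp (-(η ^ 2 * (n * ρ) / 16)) ≤ η) :
    Perr p q (bookCode c ((1 - jamFrac p q - 2 * η) * (n * ρ))) ≤ 8 * η := by
  have := nonempty_jammer (n := n) hp
  refine ciSup_le fun J => ?_
  have e1 := hG.errSilent_le hq0 (by linarith) (by positivity) J
  have e2 := hG.errActive_le hN hq0 hq2 h0 h1 hη0 hη1 hε J
  linarith

end Analysis

section Gaussian

open MeasureTheory ProbabilityTheory

theorem gaussianPDFReal_zero_one (u : ℝ) :
    gaussianPDFReal 0 1 u = Real.exp (-u ^ 2 / 2) / Real.sqrt (2 * Real.pi) := by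
  simp [gaussianPDFReal, div_eq_inv_mul]

theorem Qfun_eq (x : ℝ) : Qfun x = ∫ u in Set.Ioi x, gaussianPDFReal 0 1 u := by
  simp only [Qfun, gaussianPDFReal_zero_one]

theorem continuous_gaussianPDFReal (d : ℝ) : Continuous (gaussianPDFReal d 1) := by
  unfold gaussianPDFReal
  fun_prop

theorem gaussianPDFReal_le_one (u : ℝ) : gaussianPDFReal 0 1 u ≤ 1 := by
  rw [gaussianPDFReal_zero_one]
  refine div_le_one_of_le₀ ?_ (Real.sqrt_nonneg _)
  refine (Real.exp_le_one_iff.2 (by nlinarith [sq_nonneg u])).trans ?_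
  rw [Real.one_le_sqrt]
  linarith [Real.pi_gt_three]

theorem gaussianReal_real_Ioi (d x : ℝ) : (gaussianReal d 1).real (Set.Ioi x) = Qfun (x - d) := by
  have : gaussianReal d 1 = (gaussianReal 0 1).map (· + d) := by
    rw [gaussianReal_map_add_const, zero_add]
  rw [this, measureReal_def, Measure.map_apply (by fun_prop) measurableSet_Ioi]
  have e : (fun y : ℝ => y + d) ⁻¹' Set.Ioi x = Set.Ioi (x - d) := by
    ext y; simp [sub_lt_iff_lt_add]
  rw [e, gaussianReal_apply_eq_integral 0 one_ne_zero, ENNReal.toReal_ofReal, Qfun_eq]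
  exact setIntegral_nonneg measurableSet_Ioi fun u _ => gaussianPDFReal_nonneg _ _ _

theorem Qfun_eq_integral_shift (d x : ℝ) :
    Qfun (x - d) = ∫ u in Set.Ioi x, gaussianPDFReal d 1 u := by
  rw [← gaussianReal_real_Ioi, measureReal_def, gaussianReal_apply_eq_integral d one_ne_zero,
    ENNReal.toReal_ofReal]
  exact setIntegral_nonneg measurableSet_Ioi fun u _ => gaussianPDFReal_nonneg _ _ _

theorem Qfun_sub_Qfun (x y : ℝ) : Qfun x - Qfun y = ∫ u in x..y, gaussianPDFReal 0 1 u := by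
  rw [Qfun_eq, Qfun_eq]
  exact intervalIntegral.integral_Ioi_sub_Ioi' (integrable_gaussianPDFReal 0 1).integrableOn
    (integrable_gaussianPDFReal 0 1).integrableOn

theorem Qfun_strictAnti : StrictAnti Qfun := fun x y hxy => by
  have : 0 < ∫ u in x..y, gaussianPDFReal 0 1 u :=
    intervalIntegral.intervalIntegral_pos_of_pos
      ((continuous_gaussianPDFReal 0).intervalIntegrable _ _)
      (fun u => gaussianPDFReal_pos 0 1 u one_ne_zero) hxy
  rw [← Qfun_sub_Qfun] at this
  linarith

theorem Qfun_sub_le {x y : ℝ} (hxy : x ≤ y) : Qfun x - Qfun y ≤ y - x := by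
  rw [Qfun_sub_Qfun]
  calc _ ≤ ∫ u in x..y, (1 : ℝ) := intervalIntegral.integral_mono_on hxy
        ((continuous_gaussianPDFReal 0).intervalIntegrable _ _) (by simp)
        fun u _ => gaussianPDFReal_le_one u
    _ = y - x := by simp

theorem Qfun_neg (x : ℝ) : Qfun (-x) = 1 - Qfun x := by
  have h1 : Qfun (-x) = ∫ u in Set.Iic x, gaussianPDFReal 0 1 u := by
    rw [Qfun_eq, ← integral_comp_neg_Iic]
    simp_rw [gaussianPDFReal_zero_one, neg_sq]
  rw [h1, Qfun_eq, eq_sub_iff_add_eq, intervalIntegral.integral_Iic_add_Ioi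
    (integrable_gaussianPDFReal 0 1).integrableOn (integrable_gaussianPDFReal 0 1).integrableOn]
  exact integral_gaussianPDFReal_eq_one 0 one_ne_zero

theorem Qfun_zero : Qfun 0 = 1 / 2 := by
  have := Qfun_neg 0
  rw [neg_zero] at this
  linarith

open Filter Topology in
theorem Qfun_tendsto_atTop : Tendsto Qfun atTop (𝓝 0) := by
  have h : ∀ x, Qfun x = 1 - cdf (gaussianReal 0 1) x := fun x => by
    rw [cdf_eq_real, ← sub_zero x, ← gaussianReal_real_Ioi, ← Set.compl_Iic,
      probReal_compl_eq_one_sub measurableSet_Iic, sub_zero]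
  refine Tendsto.congr (fun x => (h x).symm) ?_
  simpa using (tendsto_cdf_atTop (gaussianReal 0 1)).const_sub 1

theorem continuous_Qfun : Continuous Qfun := by
  have : LipschitzWith 1 Qfun := LipschitzWith.of_le_add_mul _ fun x y => by
    rw [NNReal.coe_one, one_mul, Real.dist_eq]
    rcases le_total x y with h | h
    · have := Qfun_sub_le h
      rw [abs_sub_comm, abs_of_nonneg (sub_nonneg.2 h)]
      linarith
    · exact le_add_of_le_of_nonneg (Qfun_strictAnti.antitone h) (abs_nonneg _)
  exact this.continuous

theorem Qinv_Qfun (x : ℝ) : Qinv (Qfun x) = x :=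
  Function.leftInverse_invFun Qfun_strictAnti.injective x

open Filter in
theorem exists_Qfun_eq {y : ℝ} (h0 : 0 < y) (h1 : y < 1 / 2) : ∃ x, 0 < x ∧ Qfun x = y := by
  obtain ⟨b, hb1, hb0⟩ := ((Qfun_tendsto_atTop.eventually (gt_mem_nhds h0)).and
    (eventually_ge_atTop 0)).exists
  obtain ⟨x, hx, rfl⟩ := intermediate_value_Icc' hb0 continuous_Qfun.continuousOn
    (show y ∈ Set.Icc (Qfun b) (Qfun 0) from ⟨hb1.le, by rw [Qfun_zero]; exact h1.le⟩)
  refine ⟨x, lt_of_le_of_ne hx.1 fun h => ?_, rfl⟩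
  rw [← h, Qfun_zero] at h1
  exact lt_irrefl _ h1

/-- The optimal test between two unit-variance Gaussians thresholds at the midpoint. -/
theorem Qfun_sub_sub_Qfun_le {d : ℝ} (hd : 0 < d) (x : ℝ) :
    Qfun (x - d) - Qfun x ≤ 1 - 2 * Qfun (d / 2) := by
  set f : ℝ → ℝ := fun u => gaussianPDFReal d 1 u - gaussianPDFReal 0 1 u with hf
  have hfint : Integrable f := (integrable_gaussianPDFReal d 1).sub (integrable_gaussianPDFReal 0 1)
  have hx : ∀ x, Qfun (x - d) - Qfun x = ∫ u in Set.Ioi x, f u := fun x => by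
    rw [Qfun_eq_integral_shift, Qfun_eq, ← integral_sub
      (integrable_gaussianPDFReal d 1).integrableOn (integrable_gaussianPDFReal 0 1).integrableOn]
  have hset : {u | 0 ≤ f u} = Set.Ici (d / 2) := by
    ext u
    simp only [hf, gaussianPDFReal, Set.mem_ofPred_eq, Set.mem_Ici, sub_nonneg]
    rw [mul_le_mul_iff_right₀ (by positivity), Real.exp_le_exp]
    simp only [NNReal.coe_one]
    constructor <;> intro h <;> nlinarith
  rw [hx]
  refine (setIntegral_le_nonneg (f := f) measurableSet_Ioi
    ((continuous_gaussianPDFReal d).sub (continuous_gaussianPDFReal 0)).stronglyMeasurable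
    hfint).trans (le_of_eq ?_)
  rw [hset, integral_Ici_eq_integral_Ioi, ← hx]
  have : d / 2 - d = -(d / 2) := by ring
  rw [this, Qfun_neg]
  ring

end Gaussian

section CentralLimit

open MeasureTheory ProbabilityTheory Filter Topology

variable {n : ℕ}

/-- The weight of `z`, centred and normalised under the Bernoulli(`q`) distribution. -/
noncomputable def stdWt (q : ℝ) (z : BV n) : ℝ :=
  ∑ i, (if z i then 1 - q else -q) / (Real.sqrt n * Real.sqrt (q * (1 - q)))

theorem stdWt_eq (q : ℝ) (z : BV n) :
    stdWt q z = (wt z - n * q) / (Real.sqrt n * Real.sqrt (q * (1 - q))) := by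
  unfold stdWt
  rw [← Finset.sum_div, sum_if_eq]
  ring

/-- The law of the real random variable `f` on a finite probability space. -/
noncomputable def law {α : Type*} [Fintype α] (P : α → ℝ) (f : α → ℝ) : Measure ℝ :=
  ∑ a, ENNReal.ofReal (P a) • Measure.dirac (f a)

theorem isProbabilityMeasure_law {α : Type*} [Fintype α] {P : α → ℝ} (hP : IsDist P)
    (f : α → ℝ) : IsProbabilityMeasure (law P f) := by
  refine ⟨?_⟩
  simp only [law, Measure.coe_finsetSum, Finset.sum_apply, Measure.smul_apply, measure_univ,
    smul_eq_mul, mul_one]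
  rw [← ENNReal.ofReal_sum_of_nonneg fun a _ => hP.nonneg a, hP.sum_one, ENNReal.ofReal_one]

theorem law_real {α : Type*} [Fintype α] {P : α → ℝ} (hP : IsDist P) (f : α → ℝ) {s : Set ℝ}
    (hs : MeasurableSet s) : (law P f).real s = prob P (fun a => f a ∈ s) := by
  classical
  rw [measureReal_def]
  simp only [law, Measure.coe_finsetSum, Finset.sum_apply, Measure.smul_apply,
    Measure.dirac_apply' _ hs, smul_eq_mul]
  rw [ENNReal.toReal_sum fun a _ => by
    by_cases h : f a ∈ s <;> simp [h]]
  unfold prob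
  refine Finset.sum_congr rfl fun a _ => ?_
  by_cases h : f a ∈ s <;> simp [h, hP.nonneg a]

theorem charFun_law {α : Type*} [Fintype α] {P : α → ℝ} (hP : IsDist P) (f : α → ℝ) (u : ℝ) :
    charFun (law P f) u = ∑ a, (P a : ℂ) * Complex.exp (u * f a * Complex.I) := by
  rw [charFun_apply_real, law, integral_finsetSum_measure]
  · refine Finset.sum_congr rfl fun a _ => ?_
    rw [integral_smul_measure, integral_dirac, ENNReal.toReal_ofReal (hP.nonneg a),
      Complex.real_smul]
  · intro a _
    refine Integrable.smul_measure ?_ ENNReal.ofReal_ne_top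
    exact integrable_dirac (by simp)

theorem sum_noiseP_mul_cexp (r u q : ℝ) : ∑ z : BV n, (noiseP r z : ℂ) *
    Complex.exp (u * stdWt q z * Complex.I) =
    (1 + (r * Complex.exp ((u / Real.sqrt (q * (1 - q)) * (1 - q) : ℝ) * Complex.I /
        Real.sqrt n) +
      (1 - r) * Complex.exp ((-(u / Real.sqrt (q * (1 - q)) * q) : ℝ) * Complex.I /
        Real.sqrt n) - 1)) ^ n := by
  let g : Bool → ℂ := fun b => ((if b then r else 1 - r : ℝ) : ℂ) * Complex.exp (u *
    (((if b then 1 - q else -q) / (Real.sqrt n * Real.sqrt (q * (1 - q))) : ℝ) : ℂ) * Complex.I)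
  have h : ∀ z : BV n, (noiseP r z : ℂ) * Complex.exp (u * stdWt q z * Complex.I) =
      ∏ i, g (z i) := fun z => by
    rw [Finset.prod_mul_distrib, ← Complex.exp_sum]
    congr 1
    · simp [noiseP]
    · rw [← Finset.sum_mul, ← Finset.mul_sum, stdWt, Complex.ofReal_sum]
  rw [Finset.sum_congr rfl fun z _ => h z]
  refine (Fintype.prod_sum fun (_ : Fin n) (b : Bool) => g b).symm.trans ?_
  simp only [g, Fintype.sum_bool, if_true, Bool.false_eq_true, if_false, Finset.prod_const,
    Finset.card_univ, Fintype.card_fin]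
  congr 1
  push_cast
  rw [add_sub_cancel]
  congr 3 <;> ring

theorem tendsto_mul_cexp_sub (b : ℝ) : Tendsto (fun n : ℕ => (n : ℂ) *
    (Complex.exp (b * Complex.I / Real.sqrt n) - 1 - b * Complex.I / Real.sqrt n)) atTop
    (𝓝 (-(b : ℂ) ^ 2 / 2)) := by
  rw [tendsto_iff_norm_sub_tendsto_zero]
  have hlim : Tendsto (fun n : ℕ => |b| ^ 3 * Real.exp |b| / Real.sqrt n) atTop (𝓝 0) :=
    tendsto_const_nhds.div_atTop
      (Real.tendsto_sqrt_atTop.comp tendsto_natCast_atTop_atTop)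
  refine squeeze_zero' (Eventually.of_forall fun n => norm_nonneg _) ?_ hlim
  filter_upwards [eventually_ge_atTop 1] with n hn
  have hn1 : (1 : ℝ) ≤ n := by exact_mod_cast hn
  have hs1 : 1 ≤ Real.sqrt n := by rwa [Real.one_le_sqrt]
  have hs0 : (0 : ℝ) < Real.sqrt n := by linarith
  have hsq : Real.sqrt n ^ 2 = n := Real.sq_sqrt (by linarith)
  set s := Real.sqrt n with hs
  have hsc : (s : ℂ) ≠ 0 := by exact_mod_cast hs0.ne'
  have hnc : (n : ℂ) = (s : ℂ) ^ 2 := by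
    rw [← Complex.ofReal_pow, hsq, Complex.ofReal_natCast]
  have hx : ‖(b : ℂ) * Complex.I / s‖ = |b| / s := by
    rw [norm_div, norm_mul, Complex.norm_I, Complex.norm_real, Complex.norm_real, mul_one,
      Real.norm_eq_abs, Real.norm_eq_abs, abs_of_pos hs0]
  have h := Complex.norm_exp_sub_sum_le_norm_mul_exp ((b : ℂ) * Complex.I / s) 3
  have e : (n : ℂ) * (Complex.exp (b * Complex.I / s) - 1 - b * Complex.I / s) -
      -(b : ℂ) ^ 2 / 2 = (n : ℂ) * (Complex.exp ((b : ℂ) * Complex.I / s) -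
        ∑ m ∈ range 3, ((b : ℂ) * Complex.I / s) ^ m / m.factorial) := by
    simp only [Finset.sum_range_succ, Finset.sum_range_zero, pow_zero, Nat.factorial, pow_one,
      Nat.cast_one, div_one, zero_add]
    rw [hnc]
    field_simp
    rw [Complex.I_sq]
    push_cast
    ring
  rw [e, norm_mul, Complex.norm_natCast]
  rw [hx] at h
  calc (n : ℝ) * _ ≤ n * ((|b| / s) ^ 3 * Real.exp (|b| / s)) :=
        mul_le_mul_of_nonneg_left h (Nat.cast_nonneg n)
    _ ≤ n * ((|b| / s) ^ 3 * Real.exp |b|) := by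
        gcongr
        exact div_le_self (abs_nonneg b) hs1
    _ = |b| ^ 3 * Real.exp |b| / s := by
        rw [← hsq]
        field_simp

/-- Central limit theorem for the weight of a Bernoulli vector whose parameter drifts towards `q`
at rate `κ / √n`. -/
theorem tendsto_prob_stdWt {q κ : ℝ} (hq0 : 0 < q) (hq1 : q < 1) {r : ℕ → ℝ}
    (hr0 : ∀ n, 0 ≤ r n) (hr1 : ∀ n, r n ≤ 1)
    (hr : Tendsto (fun n : ℕ => Real.sqrt n * (r n - q)) atTop (𝓝 κ)) (x : ℝ) :
    Tendsto (fun n : ℕ => prob (noiseP (r n)) (fun z : BV n => x < stdWt q z)) atTop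
      (𝓝 (Qfun (x - κ / Real.sqrt (q * (1 - q))))) := by
  have hv : 0 < q * (1 - q) := mul_pos hq0 (by linarith)
  set σ := Real.sqrt (q * (1 - q)) with hσ
  have hσ0 : 0 < σ := Real.sqrt_pos.2 hv
  have hσ2 : σ ^ 2 = q * (1 - q) := Real.sq_sqrt hv.le
  have hsqrt : Tendsto (fun n : ℕ => Real.sqrt n) atTop atTop :=
    Real.tendsto_sqrt_atTop.comp tendsto_natCast_atTop_atTop
  have hrq : Tendsto r atTop (𝓝 q) := by
    have h1 : Tendsto (fun n : ℕ => Real.sqrt n * (r n - q) / Real.sqrt n) atTop (𝓝 0) :=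
      hr.div_atTop hsqrt
    have h2 : Tendsto (fun n : ℕ => Real.sqrt n * (r n - q) / Real.sqrt n + q) atTop (𝓝 q) := by
      simpa using h1.add_const q
    refine h2.congr' ?_
    filter_upwards [eventually_ge_atTop 1] with n hn
    have : (0 : ℝ) < Real.sqrt n := Real.sqrt_pos.2 (by exact_mod_cast hn)
    field_simp
    ring
  let μ : ℕ → ProbabilityMeasure ℝ := fun n =>
    ⟨law (noiseP (r n)) (fun z : BV n => stdWt q z),
      isProbabilityMeasure_law (isDist_noiseP (hr0 n) (hr1 n)) _⟩
  let μ₀ : ProbabilityMeasure ℝ := ⟨gaussianReal (κ / σ) 1, inferInstance⟩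
  have hμ : Tendsto μ atTop (𝓝 μ₀) := by
    rw [ProbabilityMeasure.tendsto_iff_tendsto_charFun]
    intro u
    have e0 : charFun (μ₀ : Measure ℝ) u = Complex.exp (u * (κ / σ : ℝ) * Complex.I - u ^ 2 / 2) := by
      change charFun (gaussianReal (κ / σ) 1) u = _
      rw [charFun_gaussianReal]
      simp
    have e1 : ∀ n, charFun (μ n : Measure ℝ) u = _ := fun n => by
      change charFun (law (noiseP (r n)) (fun z : BV n => stdWt q z)) u = _
      rw [charFun_law (isDist_noiseP (hr0 n) (hr1 n)), sum_noiseP_mul_cexp]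
    simp_rw [e0, e1]
    refine Complex.tendsto_one_add_pow_exp_of_tendsto ?_
    set a := u / σ with ha
    have hA := tendsto_mul_cexp_sub (a * (1 - q))
    have hB := tendsto_mul_cexp_sub (-(a * q))
    have hrC : Tendsto (fun n => (r n : ℂ)) atTop (𝓝 (q : ℂ)) :=
      (Complex.continuous_ofReal.tendsto q).comp hrq
    have hκC : Tendsto (fun n : ℕ => ((Real.sqrt n * (r n - q) : ℝ) : ℂ)) atTop (𝓝 (κ : ℂ)) :=
      (Complex.continuous_ofReal.tendsto κ).comp hr
    have hsum := ((hrC.mul hA).add ((hrC.const_sub 1).mul hB)).add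
      (hκC.mul_const ((a : ℂ) * Complex.I))
    refine (hsum.congr' ?_).trans (le_of_eq ?_)
    · filter_upwards [eventually_ge_atTop 1] with n hn
      have hs0 : (0 : ℝ) < Real.sqrt n := Real.sqrt_pos.2 (by exact_mod_cast hn)
      have hsc : ((Real.sqrt n : ℝ) : ℂ) ≠ 0 := by exact_mod_cast hs0.ne'
      have hnc : (n : ℂ) = ((Real.sqrt n : ℝ) : ℂ) ^ 2 := by
        rw [← Complex.ofReal_pow, Real.sq_sqrt (Nat.cast_nonneg n), Complex.ofReal_natCast]
      rw [hnc]
      push_cast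
      field_simp
      ring
    · congr 1
      have hac : (a : ℂ) * σ = u := by
        rw [← Complex.ofReal_mul, ha, div_mul_cancel₀ _ hσ0.ne']
      have hσc : (σ : ℂ) ^ 2 = q * (1 - q) := by
        rw [← Complex.ofReal_pow, hσ2]; push_cast; ring
      have hσn : (σ : ℂ) ≠ 0 := by exact_mod_cast hσ0.ne'
      rw [← hac]
      push_cast
      rw [mul_pow (a : ℂ) (σ : ℂ), hσc]
      field_simp
      ring
  have hnull : (μ₀ : Measure ℝ) (frontier (Set.Ioi x)) = 0 := by
    rw [frontier_Ioi]
    change gaussianReal (κ / σ) 1 {x} = 0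
    have := nullSingletonClass_gaussianReal (μ := κ / σ) (v := 1) one_ne_zero
    exact measure_singleton x
  have := ProbabilityMeasure.tendsto_measure_of_null_frontier_of_tendsto' hμ hnull
  have h2 := (ENNReal.tendsto_toReal (measure_ne_top (μ₀ : Measure ℝ) (Set.Ioi x))).comp this
  rw [← gaussianReal_real_Ioi]
  refine h2.congr fun n => ?_
  exact law_real (isDist_noiseP (hr0 n) (hr1 n)) _ measurableSet_Ioi

end CentralLimit

section Detection

open Filter Topology

variable {n : ℕ}

theorem noiseP_eq_exp {q : ℝ} (hq0 : 0 < q) (hq1 : q < 1) (z : BV n) :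
    noiseP q z = Real.exp (wt z * Real.log q + (n - wt z) * Real.log (1 - q)) := by
  rw [← sum_if_eq, Real.exp_sum]
  refine Finset.prod_congr rfl fun i _ => ?_
  split_ifs
  · rw [Real.exp_log hq0]
  · rw [Real.exp_log (by linarith)]

/-- Neyman–Pearson: detecting a larger crossover probability is best done by thresholding the
weight. -/
theorem exists_PFA_sub_le {q q' : ℝ} (hn : 1 ≤ n) (hq0 : 0 < q) (hqq : q < q') (hq1 : q' < 1) :
    ∃ a : ℝ, ∀ Φ : BV n → Bool, PFA q' Φ - PFA q Φ ≤
      prob (noiseP q') (fun z : BV n => a < stdWt q z) -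
        prob (noiseP q) (fun z : BV n => a < stdWt q z) := by
  classical
  have hb : Real.log (1 - q') < Real.log (1 - q) :=
    Real.log_lt_log (by linarith) (by linarith)
  have hA : Real.log q < Real.log q' := Real.log_lt_log hq0 hqq
  set b := Real.log (1 - q) - Real.log (1 - q') with hbdef
  set A := Real.log q' - Real.log q + b with hAdef
  have hA0 : 0 < A := by linarith
  have hn0 : (0 : ℝ) < n := by exact_mod_cast hn
  have hσ0 : 0 < Real.sqrt n * Real.sqrt (q * (1 - q)) :=
    mul_pos (Real.sqrt_pos.2 hn0) (Real.sqrt_pos.2 (mul_pos hq0 (by linarith)))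
  refine ⟨(n * b / A - n * q) / (Real.sqrt n * Real.sqrt (q * (1 - q))), fun Φ => ?_⟩
  have hiff : ∀ z : BV n, (n * b / A - n * q) / (Real.sqrt n * Real.sqrt (q * (1 - q))) <
      stdWt q z ↔ noiseP q z < noiseP q' z := fun z => by
    rw [stdWt_eq, div_lt_div_iff_of_pos_right hσ0, noiseP_eq_exp hq0 (by linarith),
      noiseP_eq_exp (hq0.trans hqq) hq1, Real.exp_lt_exp, sub_lt_sub_iff_right, div_lt_iff₀ hA0,
      hAdef, hbdef]
    constructor <;> intro h <;> nlinarith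
  unfold PFA prob
  rw [← Finset.sum_sub_distrib, ← Finset.sum_sub_distrib]
  refine Finset.sum_le_sum fun z _ => ?_
  simp only [hiff]
  split_ifs <;> linarith

theorem eventually_sub_le_of_tendsto_Qfun {F G : ℕ → ℝ → ℝ} {d : ℝ} (hd : 0 < d)
    (hF : ∀ n, Antitone (F n)) (hG : ∀ n, Antitone (G n)) (hF1 : ∀ n x, F n x ≤ 1)
    (hG0 : ∀ n x, 0 ≤ G n x) (hFl : ∀ x, Tendsto (fun n => F n x) atTop (𝓝 (Qfun (x - d))))
    (hGl : ∀ x, Tendsto (fun n => G n x) atTop (𝓝 (Qfun x))) {ε : ℝ} (hε : 0 < ε) :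
    ∀ᶠ n in atTop, ∀ a, F n a - G n a ≤ 1 - 2 * Qfun (d / 2) + 3 * ε := by
  have hV : 0 ≤ 1 - 2 * Qfun (d / 2) := by
    have := Qfun_strictAnti (half_pos hd)
    rw [Qfun_zero] at this
    linarith
  have hKε : Tendsto (fun K : ℕ => (K : ℝ) * ε) atTop atTop :=
    tendsto_natCast_atTop_atTop.atTop_mul_const hε
  obtain ⟨K, hK1, hK2⟩ := (((Qfun_tendsto_atTop.comp hKε).eventually (gt_mem_nhds hε)).and
    ((Qfun_tendsto_atTop.comp (tendsto_atTop_add_const_right _ (-d) hKε)).eventually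
      (gt_mem_nhds hε))).exists
  simp only [Function.comp_apply] at hK1 hK2
  have hgrid : ∀ᶠ n in atTop, ∀ i ∈ Finset.Icc (-(K : ℤ)) K,
      F n (i * ε) ≤ Qfun (i * ε - d) + ε ∧ Qfun (i * ε) - ε ≤ G n (i * ε) := by
    rw [Filter.eventually_all_finset]
    intro i _
    filter_upwards [(hFl (i * ε)).eventually (gt_mem_nhds (lt_add_of_pos_right _ hε)),
      (hGl (i * ε)).eventually (lt_mem_nhds (sub_lt_self _ hε))] with n h1 h2
    exact ⟨h1.le, h2.le⟩
  filter_upwards [hgrid] with n hn a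
  rcases le_or_gt ((K : ℝ) * ε) a with hKa | hKa
  · have h1 := (hn K (by simp)).1
    push_cast at h1
    have h2 := hF n hKa
    have h3 := hG0 n a
    rw [← sub_eq_add_neg] at hK2
    linarith
  rcases le_or_gt a (-((K : ℝ) * ε)) with hKb | hKb
  · have h1 := (hn (-K) (by simp)).2
    push_cast at h1
    rw [neg_mul, Qfun_neg] at h1
    have h2 := hG n hKb
    have h3 := hF1 n a
    linarith
  · have h1 : (⌊a / ε⌋ : ℝ) * ε ≤ a := (le_div_iff₀ hε).1 (Int.floor_le _)
    have h2 : a < (⌊a / ε⌋ + 1 : ℝ) * ε := (div_lt_iff₀ hε).1 (Int.lt_floor_add_one _)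
    have hlo : -(K : ℤ) ≤ ⌊a / ε⌋ := by
      rw [Int.le_floor, le_div_iff₀ hε]
      push_cast
      linarith
    have hhi : ⌊a / ε⌋ < (K : ℤ) := by
      rw [Int.floor_lt, div_lt_iff₀ hε]
      exact_mod_cast hKa
    have e1 := (hn ⌊a / ε⌋ (Finset.mem_Icc.2 ⟨hlo, hhi.le⟩)).1
    have e2 := (hn (⌊a / ε⌋ + 1) (Finset.mem_Icc.2 ⟨by omega, by omega⟩)).2
    push_cast at e2
    have e3 := hF n h1
    have e4 := hG n h2.le
    have e5 := Qfun_sub_sub_Qfun_le hd (⌊a / ε⌋ * ε)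
    have e6 := Qfun_sub_le (x := ⌊a / ε⌋ * ε) (y := (⌊a / ε⌋ + 1) * ε) (by linarith)
    linarith

/-- No detector distinguishes the Bernoulli distributions with parameters `q` and
`q + t / √n * (1 - 2 q)` better than the limiting Gaussian test. -/
theorem eventually_PFA_sub_le {q t ε : ℝ} (hq0 : 0 < q) (hq2 : q < 1 / 2) (ht : 0 < t)
    (hε : 0 < ε) : ∀ᶠ n : ℕ in atTop, ∀ Φ : BV n → Bool,
      PFA (q + t / Real.sqrt n * (1 - 2 * q)) Φ - PFA q Φ ≤
        1 - 2 * Qfun (t * (1 - 2 * q) / Real.sqrt (q * (1 - q)) / 2) + ε := by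
  have hσ0 : 0 < Real.sqrt (q * (1 - q)) := Real.sqrt_pos.2 (mul_pos hq0 (by linarith))
  have hsqrt : Tendsto (fun n : ℕ => Real.sqrt n) atTop atTop :=
    Real.tendsto_sqrt_atTop.comp tendsto_natCast_atTop_atTop
  have hle : ∀ᶠ n : ℕ in atTop, t / Real.sqrt n ≤ 1 :=
    ((tendsto_const_nhds.div_atTop hsqrt).eventually (gt_mem_nhds one_pos)).mono fun n h => h.le
  set r : ℕ → ℝ := fun n => q + min 1 (t / Real.sqrt n) * (1 - 2 * q) with hr
  have hm0 : ∀ n : ℕ, 0 ≤ min 1 (t / Real.sqrt n) := fun n => by positivity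
  have hm1 : ∀ n : ℕ, min 1 (t / Real.sqrt n) ≤ 1 := fun n => min_le_left _ _
  have hr0 : ∀ n, 0 ≤ r n := fun n => add_nonneg hq0.le (mul_nonneg (hm0 n) (by linarith))
  have hr1 : ∀ n, r n ≤ 1 := fun n => by
    simp only [hr]
    nlinarith [hm1 n]
  have hrl : Tendsto (fun n : ℕ => Real.sqrt n * (r n - q)) atTop (𝓝 (t * (1 - 2 * q))) := by
    refine tendsto_const_nhds.congr' ?_
    filter_upwards [hle, eventually_ge_atTop 1] with n h1 hn
    have : (0 : ℝ) < Real.sqrt n := Real.sqrt_pos.2 (by exact_mod_cast hn)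
    simp only [hr, min_eq_right h1]
    field_simp
    ring
  have hql : Tendsto (fun n : ℕ => Real.sqrt n * (q - q)) atTop (𝓝 0) := by simp
  have hF := tendsto_prob_stdWt hq0 (by linarith) hr0 hr1 hrl
  have hG := tendsto_prob_stdWt (r := fun _ => q) hq0 (by linarith) (fun _ => hq0.le)
    (fun _ => by linarith) hql
  have hd : 0 < t * (1 - 2 * q) / Real.sqrt (q * (1 - q)) :=
    div_pos (mul_pos ht (by linarith)) hσ0
  have hunif := eventually_sub_le_of_tendsto_Qfun hd
    (F := fun n x => prob (noiseP (r n)) (fun z : BV n => x < stdWt q z))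
    (G := fun n x => prob (noiseP q) (fun z : BV n => x < stdWt q z))
    (fun n x y hxy => prob_mono (noiseP_nonneg (hr0 n) (hr1 n)) fun z h => hxy.trans_lt h)
    (fun n x y hxy => prob_mono (noiseP_nonneg hq0.le (by linarith)) fun z h => hxy.trans_lt h)
    (fun n x => prob_le_one (isDist_noiseP (hr0 n) (hr1 n)) _)
    (fun n x => prob_nonneg (noiseP_nonneg hq0.le (by linarith)) _) hF
    (fun x => by simpa using hG x) (by positivity : 0 < ε / 3)
  filter_upwards [hunif, hle, eventually_ge_atTop 1] with n h1 h2 hn Φ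
  have hs : (0 : ℝ) < Real.sqrt n := Real.sqrt_pos.2 (by exact_mod_cast hn)
  have hrn : q + t / Real.sqrt n * (1 - 2 * q) = r n := by simp only [hr, min_eq_right h2]
  have hpos : 0 < t / Real.sqrt n * (1 - 2 * q) := mul_pos (div_pos ht hs) (by linarith)
  obtain ⟨a, ha⟩ := exists_PFA_sub_le (n := n) (q' := r n) hn hq0 (by linarith)
    (by rw [← hrn]; nlinarith [h2])
  rw [hrn]
  linarith [ha Φ, h1 a]

end Detection

section Asymptotics

open Filter Topology

theorem two_le_exp_one : (2 : ℝ) ≤ Real.exp 1 := by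
  linarith [Real.add_one_le_exp (1 : ℝ)]

theorem two_pow_le_exp (n : ℕ) : (2 : ℝ) ^ n ≤ Real.exp n := by
  rw [← Real.exp_one_pow]
  exact pow_le_pow_left₀ (by norm_num) two_le_exp_one n

theorem pow_le_two_pow_ceil {n : ℕ} (hn : 1 ≤ n) (k : ℕ) :
    (n : ℝ) ^ k ≤ 2 ^ ⌈k * Real.logb 2 (n : ℝ)⌉₊ := by
  have hn0 : (0 : ℝ) < n := by exact_mod_cast hn
  have h := Nat.le_ceil (k * Real.logb 2 (n : ℝ))
  rw [← Real.logb_pow, Real.logb_le_iff_le_rpow one_lt_two (by positivity),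
    Real.rpow_natCast] at h
  rw [← Real.logb_pow]
  exact h

theorem two_pow_ceil_le {n : ℕ} (hn : 1 ≤ n) (k : ℕ) :
    (2 : ℝ) ^ ⌈k * Real.logb 2 (n : ℝ)⌉₊ ≤ 2 * n ^ k := by
  have hn1 : (1 : ℝ) ≤ n := by exact_mod_cast hn
  have h := (Nat.ceil_lt_add_one (mul_nonneg (Nat.cast_nonneg k)
    (Real.logb_nonneg one_lt_two hn1))).le
  rw [← Real.logb_pow] at h ⊢
  rw [← Real.rpow_natCast]
  refine (Real.rpow_le_rpow_of_exponent_le one_le_two h).trans (le_of_eq ?_)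
  rw [Real.rpow_add two_pos, Real.rpow_one, Real.rpow_logb two_pos (by norm_num) (by positivity)]
  ring

theorem eventually_const_mul_exp_le (C : ℝ) {a ε : ℝ} (ha : a < 0) (hε : 0 < ε) :
    ∀ᶠ s : ℝ in atTop, C * Real.exp (a * s) ≤ ε := by
  have h : Tendsto (fun s : ℝ => C * Real.exp (a * s)) atTop (𝓝 (C * 0)) :=
    (Real.tendsto_exp_atBot.comp (tendsto_id.const_mul_atTop_of_neg ha)).const_mul C
  rw [mul_zero] at h
  exact (h.eventually (gt_mem_nhds hε)).mono fun _ h => h.le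

theorem eventually_const_mul_pow_mul_exp_le (C : ℝ) (k : ℕ) {ε : ℝ} (hε : 0 < ε) :
    ∀ᶠ s : ℝ in atTop, C * (s ^ k * Real.exp (-s)) ≤ ε := by
  have h := (Real.tendsto_pow_mul_exp_neg_atTop_nhds_zero k).const_mul C
  rw [mul_zero] at h
  exact (h.eventually (gt_mem_nhds hε)).mono fun _ h => h.le

theorem eventually_sq_sub_exp_le {c γ : ℝ} (hc : 0 < c) (hγ : 0 < γ) :
    ∀ᶠ s : ℝ in atTop, 2 * s ^ 2 - c * Real.exp (γ * s) ≤ -s := by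
  have h := (isLittleO_pow_exp_pos_mul_atTop 2 hγ).def (by positivity : 0 < c / 3)
  filter_upwards [h, eventually_ge_atTop 1] with s h hs
  rw [Real.norm_of_nonneg (by positivity), Real.norm_of_nonneg (by positivity)] at h
  nlinarith

theorem eventually_sq_sub_pow_le {c : ℝ} (hc : 0 < c) :
    ∀ᶠ s : ℝ in atTop, s ^ 2 - c * s ^ 12 ≤ -s := by
  filter_upwards [eventually_ge_atTop 1, eventually_ge_atTop (2 / c)] with s hs hs2
  have h1 : 2 ≤ c * s := by rw [div_le_iff₀ hc] at hs2; linarith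
  have h2 : s ^ 2 ≤ s ^ 11 := pow_le_pow_right₀ hs (by norm_num)
  have h3 : 2 * s ^ 2 ≤ c * s * s ^ 11 := mul_le_mul h1 h2 (by positivity) (by linarith)
  nlinarith

theorem jamFrac_pos {p q : ℝ} (hp : 0 < p) (hpq : p < q) (hq2 : q < 1 / 2) : 0 < jamFrac p q :=
  div_pos (mul_pos hp (by linarith)) (hp.trans hpq)

theorem jamFrac_lt {p q : ℝ} (hp : 0 < p) (hpq : p < q) : jamFrac p q < 1 := by
  unfold jamFrac
  rw [div_lt_one (hp.trans hpq)]
  nlinarith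

theorem llr_pos {q : ℝ} (hq0 : 0 < q) (hq2 : q < 1 / 2) : 0 < llr q :=
  Real.log_pos (by rw [lt_div_iff₀ hq0]; linarith)

theorem eventually_exists_goodBook {p q t R η : ℝ} (hp : 0 < p) (hpq : p < q) (hq2 : q < 1 / 2)
    (ht : 0 < t) (hη0 : 0 < η) (hη2 : η ≤ 1 / 2)
    (hRJ : llr q * ((1 - 2 * q + 2 * η) * t) < R)
    (hRB : R < t * (Real.log ((1 - jamFrac p q) / p) * (1 - jamFrac p q - 3 * η) -
      Real.log ((1 - p) / jamFrac p q) * (jamFrac p q + 4 * η))) :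
    ∀ᶠ n : ℕ in atTop, ∃ c : BV ⌈6 * Real.logb 2 (n : ℝ)⌉₊ →
      Fin ⌈Real.exp (R * Real.sqrt n)⌉₊ → BV n, GoodBook p q (t / Real.sqrt n) η c := by
  set j := jamFrac p q with hj
  set τ := Real.log ((1 - j) / p) * (1 - j - 3 * η) - Real.log ((1 - p) / j) * (j + 4 * η)
  have hj0 : 0 < j := jamFrac_pos hp hpq hq2
  have hj1 : j < 1 := jamFrac_lt hp hpq
  have hR0 : 0 < R := lt_trans
    (mul_pos (llr_pos (hp.trans hpq) hq2) (mul_pos (by linarith) ht)) hRJ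
  have hmyo : j * (Real.exp (η / 2) - 1) - η / 2 * (j + η) < 0 := by
    have := exp_sub_one_le (x := η / 2) (by rw [abs_of_pos (by linarith)]; linarith)
    nlinarith [mul_le_mul_of_nonneg_left this hj0.le, mul_pos hη0 hη0]
  set lamS := (2 * R + 1) / (η * t) with hlamS
  have hlamS0 : 0 ≤ lamS := by positivity
  have hlamS1 : lamS * (η * t) = 2 * R + 1 := div_mul_cancel₀ _ (by positivity)
  set K := Real.exp (t * ((1 + η) * t * (Real.exp lamS - 1))) with hK
  have hsqrt : Tendsto (fun n : ℕ => Real.sqrt n) atTop atTop :=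
    Real.tendsto_sqrt_atTop.comp tendsto_natCast_atTop_atTop
  filter_upwards [eventually_ge_atTop 1, hsqrt.eventually (eventually_ge_atTop t),
    hsqrt.eventually (eventually_const_mul_exp_le 2 (a := -(η ^ 2 * t / 4))
      (by rw [neg_lt_zero]; positivity) hη0),
    hsqrt.eventually (eventually_const_mul_exp_le 3 (mul_neg_of_pos_of_neg ht hmyo) hη0),
    hsqrt.eventually (eventually_const_mul_pow_mul_exp_le (16 * K) 12
      (by norm_num : (0 : ℝ) < 1 / 8)),
    hsqrt.eventually (eventually_sq_sub_exp_le (by positivity : 0 < η ^ 2) (sub_pos.2 hRJ)),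
    hsqrt.eventually (eventually_const_mul_pow_mul_exp_le 2 12 (by norm_num : (0 : ℝ) < 1 / 8)),
    hsqrt.eventually (eventually_const_mul_exp_le 4 (sub_neg.2 hRB) (by linarith : 0 < η / 4)),
    hsqrt.eventually (eventually_sq_sub_pow_le (half_pos hη0)),
    hsqrt.eventually (eventually_const_mul_exp_le 1 (neg_one_lt_zero) (by norm_num :
      (0 : ℝ) < 1 / 8))] with n hn hts hTyp hMyo hSep hRes hRes2 hπ hKey hKey2
  set s := Real.sqrt n with hs
  have hn0 : (0 : ℝ) < n := by exact_mod_cast hn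
  have hs0 : 0 < s := Real.sqrt_pos.2 hn0
  have hns : (n : ℝ) = s ^ 2 := (Real.sq_sqrt hn0.le).symm
  have hnρ : (n : ℝ) * (t / s) = t * s := by rw [hns]; field_simp
  have hN1 := Nat.le_ceil (Real.exp (R * s))
  have hN2 : (⌈Real.exp (R * s)⌉₊ : ℝ) ≤ 2 * Real.exp (R * s) := by
    have := Nat.ceil_lt_add_one (Real.exp_pos (R * s)).le
    have : 1 ≤ Real.exp (R * s) := Real.one_le_exp (by positivity)
    linarith
  have hΔ1 : s ^ 12 ≤ (2 : ℝ) ^ ⌈6 * Real.logb 2 (n : ℝ)⌉₊ := by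
    have := pow_le_two_pow_ceil hn 6
    rw [hns, ← pow_mul, ← hns] at this
    exact_mod_cast this
  have hΔ2 : (2 : ℝ) ^ ⌈6 * Real.logb 2 (n : ℝ)⌉₊ ≤ 2 * s ^ 12 := by
    have := two_pow_ceil_le hn 6
    rw [show (n : ℝ) ^ 6 = s ^ 12 by rw [hns, ← pow_mul]] at this
    exact_mod_cast this
  have h2n : (2 : ℝ) ^ n ≤ Real.exp (s ^ 2) := by rw [← hns]; exact two_pow_le_exp n
  refine exists_goodBook (lamS := lamS) (lamM := η / 2) hp hpq hq2 (by positivity)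
    ((div_le_one hs0).2 hts) hη0 hη2 hlamS0 (by positivity) ?_ ?_ ?_ ?_ ?_ ?_
  · rw [hnρ]
    convert hTyp using 3
    ring
  · rw [hnρ]
    convert hMyo using 3
    ring
  · rw [hnρ]
    calc _ ≤ 2 * s ^ 12 * ((2 * Real.exp (R * s)) ^ 2 * (2 * Real.exp (t / s *
          ((1 + η) * (t * s) * (Real.exp lamS - 1)) - lamS * (η * (t * s))))) := by gcongr
      _ = 16 * K * (s ^ 12 * Real.exp (-s)) := by
          have e : t / s * ((1 + η) * (t * s) * (Real.exp lamS - 1)) - lamS * (η * (t * s)) =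
              t * ((1 + η) * t * (Real.exp lamS - 1)) + (-(R * s) + (-(R * s) + -s)) := by
            rw [show lamS * (η * (t * s)) = (2 * R + 1) * s by rw [← hlamS1]; ring]
            field_simp
            ring
          rw [e, Real.exp_add, Real.exp_add, Real.exp_add, ← hK, Real.exp_neg (R * s)]
          field_simp
          ring
      _ ≤ 1 / 8 := hSep
  · rw [hnρ]
    calc _ ≤ 2 * s ^ 12 * (Real.exp (s ^ 2) * Real.exp (s ^ 2) * Real.exp (-(η ^ 2 *
          Real.exp (R * s) / Real.exp (llr q * ((1 - 2 * q + 2 * η) * (t * s)))))) := by gcongr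
      _ ≤ 2 * s ^ 12 * Real.exp (-s) := by
          refine mul_le_mul_of_nonneg_left ?_ (by positivity)
          rw [← Real.exp_add, ← Real.exp_add, mul_div_assoc, ← Real.exp_sub]
          refine Real.exp_le_exp.2 (le_trans (le_of_eq ?_) hRes)
          rw [show R * s - llr q * ((1 - 2 * q + 2 * η) * (t * s)) =
            (R - llr q * ((1 - 2 * q + 2 * η) * t)) * s by ring]
          ring
      _ ≤ 1 / 8 := by rw [mul_assoc]; exact hRes2
  · rw [hnρ]
    calc _ ≤ 2 * Real.exp (R * s) * (2 * Real.exp (-(t * s * τ))) := by gcongr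
      _ = 4 * Real.exp ((R - t * τ) * s) := by
          rw [show (R - t * τ) * s = R * s + -(t * s * τ) by ring, Real.exp_add]
          ring
      _ ≤ η / 4 := hπ
  · calc _ ≤ Real.exp (s ^ 2) * Real.exp (-(η * s ^ 12 / 2)) := by gcongr
      _ = Real.exp (s ^ 2 - η / 2 * s ^ 12) := by rw [← Real.exp_add]; congr 1; ring
      _ ≤ Real.exp (-1 * s) := Real.exp_le_exp.2 (by linarith)
      _ ≤ 1 / 8 := by rw [one_mul] at hKey2; exact hKey2

end Asymptotics

section Assembly

open Filter Topology

variable {n N Δ : ℕ}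

instance : Finite (Code n N Δ) :=
  Finite.of_injective (fun C => (C.enc, C.dec)) fun C C' h => by
    cases C
    cases C'
    simp_all

instance : Nonempty (Code n N Δ) := ⟨⟨fun _ _ _ => false, fun _ _ => none⟩⟩

theorem covertGap_le_one {q : ℝ} (hq0 : 0 ≤ q) (hq1 : q ≤ 1) (C : Code n N Δ) :
    covertGap q C ≤ 1 := by
  refine (ciInf_le (Set.finite_range _).bddBelow fun _ => true).trans (le_of_eq ?_)
  simp [PFA, PMD, (isDist_noiseP hq0 hq1).sum_one]

theorem eventually_exists_code {p q t R ε : ℝ} (hp : 0 < p) (hpq : p < q) (hq2 : q < 1 / 2)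
    (ht : 0 < t) (hRJ : llr q * ((1 - 2 * q) * t) < R)
    (hRB : R < t * (Real.log ((1 - jamFrac p q) / p) * (1 - jamFrac p q) -
      Real.log ((1 - p) / jamFrac p q) * jamFrac p q)) (hε : 0 < ε) :
    ∀ᶠ n : ℕ in atTop, ∃ C : Code n ⌈Real.exp (R * Real.sqrt n)⌉₊ ⌈6 * Real.logb 2 (n : ℝ)⌉₊,
      Perr p q C ≤ ε ∧
        2 * Qfun (t * (1 - 2 * q) / Real.sqrt (q * (1 - q)) / 2) - ε ≤ covertGap q C := by
  have hq0 : 0 < q := hp.trans hpq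
  set j := jamFrac p q with hj
  have h1 : Tendsto (fun η : ℝ => llr q * ((1 - 2 * q + 2 * η) * t)) (𝓝[>] 0)
      (𝓝 (llr q * ((1 - 2 * q) * t))) := by
    have : Continuous fun η : ℝ => llr q * ((1 - 2 * q + 2 * η) * t) := by fun_prop
    simpa using (this.tendsto 0).mono_left nhdsWithin_le_nhds
  have h2 : Tendsto (fun η : ℝ => t * (Real.log ((1 - j) / p) * (1 - j - 3 * η) -
      Real.log ((1 - p) / j) * (j + 4 * η))) (𝓝[>] 0)
      (𝓝 (t * (Real.log ((1 - j) / p) * (1 - j) - Real.log ((1 - p) / j) * j))) := by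
    have : Continuous fun η : ℝ => t * (Real.log ((1 - j) / p) * (1 - j - 3 * η) -
      Real.log ((1 - p) / j) * (j + 4 * η)) := by fun_prop
    simpa using (this.tendsto 0).mono_left nhdsWithin_le_nhds
  obtain ⟨η, hη1, hη2, ⟨hη0, hη3⟩⟩ := ((h1.eventually (gt_mem_nhds hRJ)).and
    ((h2.eventually (lt_mem_nhds hRB)).and (Ioo_mem_nhdsGT
      (lt_min (by norm_num : (0 : ℝ) < 1 / 2) (by positivity : 0 < ε / 12))))).exists
  have hη4 : η < 1 / 2 := hη3.trans_le (min_le_left _ _)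
  have hη5 : η < ε / 12 := hη3.trans_le (min_le_right _ _)
  have hsqrt : Tendsto (fun n : ℕ => Real.sqrt n) atTop atTop :=
    Real.tendsto_sqrt_atTop.comp tendsto_natCast_atTop_atTop
  filter_upwards [eventually_exists_goodBook hp hpq hq2 ht hη0 hη4.le hη1 hη2,
    eventually_PFA_sub_le hq0 hq2 ht (half_pos hε), eventually_ge_atTop 1,
    hsqrt.eventually (eventually_ge_atTop t),
    hsqrt.eventually (eventually_const_mul_exp_le 1 (a := -(η ^ 2 * t / 16))
      (by rw [neg_lt_zero]; positivity) hη0)] with n hbook hD hn hts hexp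
  obtain ⟨c, hc⟩ := hbook
  have hn0 : (0 : ℝ) < n := by exact_mod_cast hn
  have hs0 : 0 < Real.sqrt n := Real.sqrt_pos.2 hn0
  have hρ0 : 0 ≤ t / Real.sqrt n := by positivity
  have hρ1 : t / Real.sqrt n ≤ 1 := (div_le_one hs0).2 hts
  have hN : 0 < ⌈Real.exp (R * Real.sqrt n)⌉₊ := Nat.ceil_pos.2 (Real.exp_pos _)
  have hexp' : Real.exp (-(η ^ 2 * (n * (t / Real.sqrt n)) / 16)) ≤ η := by
    rw [one_mul] at hexp
    convert hexp using 2
    have : (n : ℝ) * (t / Real.sqrt n) = t * Real.sqrt n := by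
      rw [div_eq_mul_inv, mul_left_comm, ← div_eq_mul_inv, Real.div_sqrt]
    rw [this]
    ring
  refine ⟨bookCode c ((1 - jamFrac p q - 2 * η) * (n * (t / Real.sqrt n))), ?_, ?_⟩
  · have := hc.Perr_le hN hp.le hq0 hq2 hρ0 hρ1 hη0 hη4.le hexp'
    linarith
  · have := hc.covertGap_ge hN hq0 hq2 hρ0 hρ1 hη0 (by linarith) hexp' hD
      ((1 - jamFrac p q - 2 * η) * (n * (t / Real.sqrt n)))
    linarith

theorem IB_mul_log_two {p q : ℝ} (hp : 0 < p) (hpq : p < q) (hq2 : q < 1 / 2) :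
    IB p q * Real.log 2 = Real.log ((1 - jamFrac p q) / p) * (1 - jamFrac p q) -
      Real.log ((1 - p) / jamFrac p q) * jamFrac p q := by
  have hq0 : 0 < q := hp.trans hpq
  have hj0 := jamFrac_pos hp hpq hq2
  have hj1 := jamFrac_lt hp hpq
  have hl2 : Real.log 2 ≠ 0 := (Real.log_pos one_lt_two).ne'
  have e1 : (q - p + p * q) * (1 - p) / (p ^ 2 * (1 - q)) =
      (1 - jamFrac p q) / p * ((1 - p) / jamFrac p q) := by
    have : 1 - q ≠ 0 := by linarith
    unfold jamFrac
    field_simp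
    ring
  have e2 : (q - p + p * q) / (p * q) = (1 - jamFrac p q) / p := by
    unfold jamFrac
    field_simp
    ring
  have e3 : p * (q - 1) / q = -jamFrac p q := by
    unfold jamFrac
    ring
  have hp1 : 0 < 1 - p := by linarith
  have hj2 : 0 < 1 - jamFrac p q := by linarith
  unfold IB
  rw [e1, e2, e3, add_mul, mul_assoc, Real.logb, Real.logb, div_mul_cancel₀ _ hl2,
    div_mul_cancel₀ _ hl2, Real.log_mul (by positivity) (by positivity)]
  ring

theorem IJ_mul_log_two (q : ℝ) : IJ q * Real.log 2 = llr q * (1 - 2 * q) := by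
  have hl2 : Real.log 2 ≠ 0 := (Real.log_pos one_lt_two).ne'
  unfold IJ llr
  rw [Real.logb, mul_assoc, div_mul_cancel₀ _ hl2, mul_comm]

theorem tpar_pos_and_Qfun_eq {q εd : ℝ} (hq0 : 0 < q) (hq2 : q < 1 / 2) (he0 : 0 < εd)
    (he1 : εd < 1) : 0 < tpar q εd ∧
      2 * Qfun (tpar q εd * (1 - 2 * q) / Real.sqrt (q * (1 - q)) / 2) = 1 - εd := by
  have hσ0 : 0 < Real.sqrt (q * (1 - q)) := Real.sqrt_pos.2 (mul_pos hq0 (by linarith))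
  have hq : 0 < 1 - 2 * q := by linarith
  obtain ⟨x, hx0, hx⟩ := exists_Qfun_eq (y := (1 - εd) / 2) (by linarith) (by linarith)
  have ht : tpar q εd = 2 * Real.sqrt (q * (1 - q)) / (1 - 2 * q) * x := by
    rw [tpar, ← hx, Qinv_Qfun]
  refine ⟨by rw [ht]; positivity, ?_⟩
  rw [show tpar q εd * (1 - 2 * q) / Real.sqrt (q * (1 - q)) / 2 = x by rw [ht]; field_simp, hx]
  ring

end Assembly

/-- Theorem 3, small-sized key regime.  If
`0 < p < q < 1/2`, `εd ∈ (0,1)` and `I_B(p,q) > I_J(q)`, then for every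
`δ > 0` the relative throughput `t(q,εd)·I_B(p,q) − δ` is achievable with key
sizes `Δ(n) = ⌈6 log₂ n⌉`: there is a `(1 − εd)`-covert sequence of codes with
`⌈6 log₂ n⌉` key bits whose relative throughput is at least
`t(q,εd)·I_B(p,q) − δ` for all sufficiently large `n`, and whose probability of
error tends to `0`. -/
theorem covert_achievability_small_key (p q εd : ℝ)
    (hp0 : 0 < p) (hpq : p < q) (hq2 : q < 1 / 2)
    (he0 : 0 < εd) (he1 : εd < 1) (hI : IJ q < IB p q) :
    ∀ δ : ℝ, 0 < δ →
      ∃ (N : ℕ → ℕ)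
        (C : ∀ n : ℕ, Code n (N n) (⌈6 * Real.logb 2 (n : ℝ)⌉₊)),
        IsCovertSeq q εd N (fun n => ⌈6 * Real.logb 2 (n : ℝ)⌉₊) C ∧
        (∀ᶠ n : ℕ in Filter.atTop,
          tpar q εd * IB p q - δ ≤ Real.logb 2 (N n) / Real.sqrt n) ∧
        Filter.Tendsto (fun n => Perr p q (C n)) Filter.atTop (nhds 0) := by
  intro δ hδ
  have hq0 : 0 < q := hp0.trans hpq
  obtain ⟨ht, hQ⟩ := tpar_pos_and_Qfun_eq hq0 hq2 he0 he1
  set t := tpar q εd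
  have hl2 : 0 < Real.log 2 := Real.log_pos one_lt_two
  have hgap : 0 < t * (IB p q - IJ q) := mul_pos ht (sub_pos.2 hI)
  set δ' := min δ (t * (IB p q - IJ q) / 2)
  have hδ' : 0 < δ' := lt_min hδ (half_pos hgap)
  have hδ1 : δ' ≤ δ := min_le_left _ _
  have hδ2 : δ' ≤ t * (IB p q - IJ q) / 2 := min_le_right _ _
  set R := (t * IB p q - δ') * Real.log 2 with hR
  have hRJ : llr q * ((1 - 2 * q) * t) < R := by
    rw [← mul_assoc, ← IJ_mul_log_two, mul_right_comm]
    exact mul_lt_mul_of_pos_right (by linarith) hl2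
  have hRB : R < t * (Real.log ((1 - jamFrac p q) / p) * (1 - jamFrac p q) -
      Real.log ((1 - p) / jamFrac p q) * jamFrac p q) := by
    rw [← IB_mul_log_two hp0 hpq hq2, ← mul_assoc]
    exact mul_lt_mul_of_pos_right (by linarith) hl2
  choose C hC using fun n : ℕ => Finite.exists_min
    fun C : Code n ⌈Real.exp (R * Real.sqrt n)⌉₊ ⌈6 * Real.logb 2 (n : ℝ)⌉₊ =>
      max (Perr p q C) (1 - εd - covertGap q C)
  have hsmall : ∀ ε : ℝ, 0 < ε → ∀ᶠ n in Filter.atTop,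
      max (Perr p q (C n)) (1 - εd - covertGap q (C n)) ≤ ε := fun ε hε => by
    filter_upwards [eventually_exists_code hp0 hpq hq2 ht hRJ hRB hε] with n hn
    obtain ⟨C', h1, h2⟩ := hn
    exact (hC n C').trans (max_le h1 (by rw [hQ] at h2; linarith))
  refine ⟨fun n => ⌈Real.exp (R * Real.sqrt n)⌉₊, C, ?_, ?_, ?_⟩
  · refine le_of_forall_pos_le_add fun ε hε => ?_
    rw [← sub_le_iff_le_add]
    refine Filter.le_liminf_of_le (Filter.isCoboundedUnder_ge_of_le _
      fun n => covertGap_le_one hq0.le (by linarith) (C n)) ?_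
    filter_upwards [hsmall ε hε] with n hn
    linarith [(le_max_right _ _).trans hn]
  · filter_upwards [Filter.eventually_ge_atTop 1] with n hn
    have hs0 : 0 < Real.sqrt n := Real.sqrt_pos.2 (by exact_mod_cast hn)
    rw [le_div_iff₀ hs0]
    calc _ ≤ (t * IB p q - δ') * Real.sqrt n := by gcongr
      _ = Real.logb 2 (Real.exp (R * Real.sqrt n)) := by
          rw [Real.logb, Real.log_exp, hR]
          field_simp
      _ ≤ _ := Real.logb_le_logb_of_le one_lt_two (Real.exp_pos _) (Nat.le_ceil _)
  · rw [Metric.tendsto_nhds]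
    intro ε hε
    filter_upwards [hsmall (ε / 2) (half_pos hε)] with n hn
    rw [Real.dist_eq, sub_zero, abs_of_nonneg (Perr_nonneg hq0.le (by linarith) (C n))]
    linarith [(le_max_left _ _).trans hn]

end CovertComm
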